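/- Let k < n be positive integers and let Λ₁,…,Λ_k be partitions of n with Σᵢ(n − l(Λᵢ)) = n − 1, where l(Λ) denotes the number of parts of Λ. Then for any pairwise distinct real numbers w₁,…,w_k the set S_{Λ₁,…,Λ_k}(w₁,…,w_k) is finite, and for any two choices (w₁,…,w_k) and (w₁′,…,w_k′) of pairwise distinct real numbers the s-numbers agree: Σ_{P∈S_{Λ₁,…,Λ_k}(w₁,…,w_k)} ε(P) = Σ_{P∈S_{Λ₁,…,Λ_k}(w₁′,…,w_k′)} ε(P). In particular the s-number does not depend on the order of the branch points on the real line, only on the partitions Λ₁,…,Λ_k. -/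

import Mathlib

open Polynomial
open scoped Classical

/-- The ramification type of `w` for a real polynomial `P`: the multiset of
multiplicities of the complex roots of `P - w`. -/
noncomputable def ramType (P : Polynomial ℝ) (w : ℝ) : Multiset ℕ :=
  ((P.map (algebraMap ℝ ℂ) - Polynomial.C (w : ℂ)).roots.toFinset.val).map
    fun z => (P.map (algebraMap ℝ ℂ) - Polynomial.C (w : ℂ)).rootMultiplicity z

/-- A disorder of `P`: a pair `x₁ < x₂` with `P x₁ = P x₂` and the multiplicity of `x₁`
as a root of `P - P x₁` strictly greater than that of `x₂`. -/
def disorders (P : Polynomial ℝ) : Set (ℝ × ℝ) :=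
  {p | p.1 < p.2 ∧ P.eval p.1 = P.eval p.2 ∧
    (P - Polynomial.C (P.eval p.2)).rootMultiplicity p.2
      < (P - Polynomial.C (P.eval p.1)).rootMultiplicity p.1}

/-- The sign `ε(P) = (-1)^{number of disorders}`. -/
noncomputable def epsilonP (P : Polynomial ℝ) : ℤ := (-1) ^ Nat.card (disorders P)

/-- `P = X^n + a₂ X^(n-2) + ⋯ + a_n`: monic of degree `n` with vanishing coefficient
of `X^(n-1)`. -/
def IsNormalized (n : ℕ) (P : Polynomial ℝ) : Prop :=
  P.natDegree = n ∧ P.Monic ∧ P.coeff (n - 1) = 0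

/-- A multiset of positive integers summing to `n`. -/
def IsPartitionOf (n : ℕ) (Λ : Multiset ℕ) : Prop := Λ.sum = n ∧ 0 ∉ Λ

/-- The set `S_{Λ₁,…,Λ_k}(w₁,…,w_k)` of normalized real polynomials of degree `n` with
ramification type `Λ i` at `w i` for every `i`. -/
noncomputable def sSet (n : ℕ) {k : ℕ} (Λ : Fin k → Multiset ℕ) (w : Fin k → ℝ) :
    Set (Polynomial ℝ) :=
  {P | IsNormalized n P ∧ ∀ i, ramType P (w i) = Λ i}

section Degree

open scoped ContDiff

variable {ι : Type*} [Fintype ι]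

/-- The determinant as a continuous multilinear function of the rows. -/
noncomputable def rowDet (ι : Type*) [Fintype ι] :
    ContinuousMultilinearMap ℝ (fun _ : ι => ι → ℝ) ℝ :=
  { (Matrix.detRowAlternating (n := ι) (R := ℝ)).toMultilinearMap with
    cont := by
      change Continuous fun M : Matrix ι ι ℝ => M.det
      exact continuous_id.matrix_det }

theorem rowDet_apply (v : ι → ι → ℝ) : rowDet ι v = Matrix.det (Matrix.of v) := rfl

theorem rowDet_swap (v : ι → ι → ℝ) {i j : ι} (hij : i ≠ j) :
    rowDet ι (v ∘ Equiv.swap i j) = - rowDet ι v :=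
  (Matrix.detRowAlternating (n := ι) (R := ℝ)).map_swap v hij

/-- The partial derivative of `H` along the basis vector `b`. -/
noncomputable def partialDeriv (H : (ι → ℝ) → (ι → ℝ)) (b : ι) (x : ι → ℝ) : ι → ℝ :=
  fderiv ℝ H x (Pi.single b 1)

theorem det_fderiv_eq_rowDet (H : (ι → ℝ) → (ι → ℝ)) (x : ι → ℝ) :
    (fderiv ℝ H x).det = rowDet ι (fun b => partialDeriv H b x) := by
  rw [ContinuousLinearMap.det, ← LinearMap.det_toMatrix', ← Matrix.det_transpose, rowDet_apply]
  congr 1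

/-- The Jacobian determinant with the column `b` replaced by `e`. -/
noncomputable def cramerField (H : (ι → ℝ) → (ι → ℝ)) (e : ι → ℝ) (b : ι) (x : ι → ℝ) : ℝ :=
  rowDet ι (Function.update (fun b' => partialDeriv H b' x) b e)

theorem sum_cramerField_mul (H : (ι → ℝ) → (ι → ℝ)) (e : ι → ℝ) (x : ι → ℝ)
    (φ : (ι → ℝ) →L[ℝ] ℝ) :
    ∑ b, φ (partialDeriv H b x) * cramerField H e b x = φ e * (fderiv ℝ H x).det := by
  set A : Matrix ι ι ℝ := Matrix.of fun a b => partialDeriv H b x a with hA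
  have h1 : ∀ b, cramerField H e b x = A.cramer e b := by
    intro b
    rw [Matrix.cramer_apply, ← Matrix.det_transpose, cramerField, rowDet_apply]
    congr 1
    ext i j
    by_cases h : i = b
    · subst h; simp
    · simp [h, hA]
  have h2 : (fderiv ℝ H x).det = A.det := by
    rw [det_fderiv_eq_rowDet, rowDet_apply, ← Matrix.det_transpose]; rfl
  have h3 : A.mulVec (A.cramer e) = A.det • e := Matrix.mulVec_cramer A e
  have h4 : ∑ b, A.cramer e b • partialDeriv H b x = A.det • e := by
    rw [← h3]
    ext a
    simp [Matrix.mulVec, dotProduct, hA, mul_comm]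
  have h5 := congrArg φ h4
  simp only [map_sum, map_smul, smul_eq_mul] at h5
  rw [h2, mul_comm, ← h5]
  exact Finset.sum_congr rfl fun b _ => by rw [h1, mul_comm]

theorem contDiff_partialDeriv {H : (ι → ℝ) → (ι → ℝ)} (hH : ContDiff ℝ ∞ H) (b : ι) :
    ContDiff ℝ ∞ (partialDeriv H b) := by
  unfold partialDeriv
  exact (hH.fderiv_right (m := ∞) (by simp)).clm_apply contDiff_const

theorem contDiff_cramerField {H : (ι → ℝ) → (ι → ℝ)} (hH : ContDiff ℝ ∞ H) (e : ι → ℝ) (b : ι) :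
    ContDiff ℝ ∞ (cramerField H e b) := by
  unfold cramerField
  refine (rowDet ι).contDiff.comp (contDiff_pi.2 fun i => ?_)
  by_cases h : i = b
  · subst h; simpa using contDiff_const
  · simpa [h] using contDiff_partialDeriv hH i

theorem sum_fderiv_cramerField {H : (ι → ℝ) → (ι → ℝ)} (hH : ContDiff ℝ ∞ H) (e : ι → ℝ)
    (x : ι → ℝ) : ∑ b, fderiv ℝ (cramerField H e b) x (Pi.single b 1) = 0 := by
  set h : ι → ι → ι → ℝ := fun i b => fderiv ℝ (partialDeriv H i) x (Pi.single b 1) with hh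
  have hsymm : ∀ i b, h i b = h b i := by
    intro i b
    have h2 : IsSymmSndFDerivAt ℝ H x :=
      (hH.contDiffAt (x := x)).isSymmSndFDerivAt (by simpa using ENat.LEInfty.out)
    have hd : DifferentiableAt ℝ (fderiv ℝ H) x :=
      ((hH.fderiv_right (m := ∞) (by simp)).differentiable (by simp)).differentiableAt
    have key : ∀ i b, h i b = fderiv ℝ (fderiv ℝ H) x (Pi.single b 1) (Pi.single i 1) := by
      intro i b
      simp only [hh]
      have := hd.hasFDerivAt.clm_apply (hasFDerivAt_const (Pi.single i (1 : ℝ) : ι → ℝ) x)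
      rw [show partialDeriv H i = fun y => fderiv ℝ H y (Pi.single i 1) from rfl, this.fderiv]
      simp
    rw [key, key, h2]
  have hder : ∀ b, fderiv ℝ (cramerField H e b) x (Pi.single b 1) =
      ∑ i, if i = b then 0 else rowDet ι (Function.update
        (Function.update (fun b' => partialDeriv H b' x) b e) i (h i b)) := by
    intro b
    have := HasFDerivAt.multilinear_comp (rowDet ι)
      (g := fun i y => Function.update (fun b' => partialDeriv H b' y) b e i)
      (g' := fun i => if i = b then 0 else fderiv ℝ (partialDeriv H i) x) (x := x) (by
        intro i
        by_cases hi : i = b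
        · subst hi; simpa only [Function.update_self, if_true] using hasFDerivAt_const e x
        · simpa [hi] using
            (((contDiff_partialDeriv hH i).differentiable (by simp)).differentiableAt).hasFDerivAt)
    have h2 : fderiv ℝ (cramerField H e b) x = _ := this.fderiv
    rw [h2, sum_apply]
    refine Finset.sum_congr rfl fun i _ => ?_
    by_cases hi : i = b
    · simp [hi]
    · simp [hi, ContinuousMultilinearMap.toContinuousLinearMap, hh]
  simp_rw [hder]
  rw [← Finset.sum_product' (f := fun b i => if i = b then 0 else rowDet ι (Function.update
        (Function.update (fun b' => partialDeriv H b' x) b e) i (h i b)))]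
  refine Finset.sum_involution (fun p _ => p.swap) ?_ ?_ (by simp) (by simp)
  · rintro ⟨b, i⟩ -
    by_cases hi : i = b
    · simp [hi]
    · have hb : b ≠ i := fun h => hi h.symm
      simp only [Prod.swap_prod_mk, hi, hb, if_false]
      rw [hsymm b i, add_eq_zero_iff_eq_neg, ← rowDet_swap _ hi]
      congr 1
      funext j
      by_cases h1 : j = i
      · subst h1; simp
      · by_cases h2 : j = b
        · subst h2; simp [hb, hi]
        · simp [Equiv.swap_apply_of_ne_of_ne h1 h2, h1, h2]
  · rintro ⟨b, i⟩ - hne heq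
    simp only [Prod.swap_prod_mk, Prod.mk.injEq] at heq
    simp [heq.1] at hne

end Degree

section DegreeIntegral

open scoped ContDiff Topology
open MeasureTheory Metric

variable {ι : Type*} [Fintype ι]

/-- Preimages of bounded sets are bounded. -/
def BoundedPreimages (H : (ι → ℝ) → (ι → ℝ)) : Prop :=
  ∀ R : ℝ, ∃ R' : ℝ, ∀ x, ‖H x‖ ≤ R → ‖x‖ ≤ R'

theorem exists_bound_of_ne_zero {H : (ι → ℝ) → (ι → ℝ)} (hp : BoundedPreimages H)
    {E : Type*} [Zero E] {g : (ι → ℝ) → E} (hg : HasCompactSupport g) (r : ℝ) :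
    ∃ R, ∀ x z, ‖z‖ ≤ r → R < ‖x‖ → g (H x - z) = 0 := by
  obtain ⟨s, hs⟩ := hg.isCompact.isBounded.exists_norm_le
  obtain ⟨R, hR⟩ := hp (s + r)
  refine ⟨R, fun x z hz hx => ?_⟩
  by_contra hne
  have h1 := hs _ (subset_tsupport g hne)
  have h2 : ‖H x‖ ≤ s + r := by
    calc ‖H x‖ = ‖(H x - z) + z‖ := by simp
      _ ≤ _ := (norm_add_le _ _).trans (add_le_add h1 hz)
  exact absurd (hR x h2) (not_le.2 hx)

theorem hasCompactSupport_comp_sub {H : (ι → ℝ) → (ι → ℝ)} (hp : BoundedPreimages H)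
    {E : Type*} [Zero E] {g : (ι → ℝ) → E} (hg : HasCompactSupport g) (z : ι → ℝ) :
    HasCompactSupport fun x => g (H x - z) := by
  obtain ⟨R, hR⟩ := exists_bound_of_ne_zero hp hg ‖z‖
  refine HasCompactSupport.intro (isCompact_closedBall 0 R) fun x hx => hR x z le_rfl ?_
  simpa using hx

/-- The degree integral of `H` at `z` against the test function `ψ`. -/
noncomputable def degreeIntegral (H : (ι → ℝ) → (ι → ℝ)) (ψ : (ι → ℝ) → ℝ) (z : ι → ℝ) : ℝ :=
  ∫ x, ψ (H x - z) * (fderiv ℝ H x).det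

theorem continuous_det_fderiv {H : (ι → ℝ) → (ι → ℝ)} (hH : ContDiff ℝ ∞ H) :
    Continuous fun x => (fderiv ℝ H x).det :=
  ContinuousLinearMap.continuous_det.comp (hH.continuous_fderiv (by simp))

theorem integral_fderiv_mul_det {H : (ι → ℝ) → (ι → ℝ)} (hH : ContDiff ℝ ∞ H)
    (hp : BoundedPreimages H) {ψ : (ι → ℝ) → ℝ} (hψ : ContDiff ℝ ∞ ψ)
    (hc : HasCompactSupport ψ) (z e : ι → ℝ) :
    ∫ x, fderiv ℝ ψ (H x - z) e * (fderiv ℝ H x).det = 0 := by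
  set φ : (ι → ℝ) → ℝ := fun x => ψ (H x - z) with hφ
  have hφs : ContDiff ℝ ∞ φ := hψ.comp (hH.sub contDiff_const)
  have hφc : HasCompactSupport φ := hasCompactSupport_comp_sub hp hc z
  have hφd : ∀ x b, fderiv ℝ φ x (Pi.single b 1) = fderiv ℝ ψ (H x - z) (partialDeriv H b x) := by
    intro x b
    have h1 : HasFDerivAt (fun x => H x - z) (fderiv ℝ H x) x :=
      ((hH.differentiable (by simp)).differentiableAt.hasFDerivAt).sub_const z
    have h2 : HasFDerivAt ψ (fderiv ℝ ψ (H x - z)) (H x - z) :=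
      (hψ.differentiable (by simp)).differentiableAt.hasFDerivAt
    have h3 : HasFDerivAt φ ((fderiv ℝ ψ (H x - z)).comp (fderiv ℝ H x)) x := h2.comp x h1
    rw [h3.fderiv]
    rfl
  have hfc : ∀ b, Continuous fun x => fderiv ℝ φ x (Pi.single b 1) := fun b =>
    (hφs.continuous_fderiv (by simp)).clm_apply continuous_const
  have hfs : ∀ b, HasCompactSupport fun x => fderiv ℝ φ x (Pi.single b 1) := fun b =>
    hφc.fderiv_apply ℝ _
  have hCc : ∀ b, Continuous (cramerField H e b) := fun b => (contDiff_cramerField hH e b).continuous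
  have hCd : ∀ b, Continuous fun x => fderiv ℝ (cramerField H e b) x (Pi.single b 1) := fun b =>
    ((contDiff_cramerField hH e b).continuous_fderiv (by simp)).clm_apply continuous_const
  have i1 : ∀ b, Integrable fun x => fderiv ℝ φ x (Pi.single b 1) * cramerField H e b x :=
    fun b => ((hfc b).mul (hCc b)).integrable_of_hasCompactSupport ((hfs b).mul_right)
  have i2 : ∀ b, Integrable fun x => φ x * fderiv ℝ (cramerField H e b) x (Pi.single b 1) :=
    fun b => (hφs.continuous.mul (hCd b)).integrable_of_hasCompactSupport hφc.mul_right
  have i3 : ∀ b, Integrable fun x => φ x * cramerField H e b x :=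
    fun b => (hφs.continuous.mul (hCc b)).integrable_of_hasCompactSupport hφc.mul_right
  have key : ∀ b, ∫ x, fderiv ℝ φ x (Pi.single b 1) * cramerField H e b x =
      - ∫ x, φ x * fderiv ℝ (cramerField H e b) x (Pi.single b 1) := fun b => by
    rw [integral_mul_fderiv_eq_neg_fderiv_mul_of_integrable (i1 b) (i2 b) (i3 b)
      (fun x _ => (hφs.differentiable (by simp)).differentiableAt)
      (fun x _ => ((contDiff_cramerField hH e b).differentiable (by simp)).differentiableAt),
      neg_neg]
  calc ∫ x, fderiv ℝ ψ (H x - z) e * (fderiv ℝ H x).det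
      = ∫ x, ∑ b, fderiv ℝ φ x (Pi.single b 1) * cramerField H e b x := by
        congr 1; ext x
        rw [← sum_cramerField_mul H e x]
        simp_rw [hφd]
    _ = ∑ b, - ∫ x, φ x * fderiv ℝ (cramerField H e b) x (Pi.single b 1) := by
        rw [integral_finsetSum _ fun b _ => i1 b]
        exact Finset.sum_congr rfl fun b _ => key b
    _ = - ∫ x, ∑ b, φ x * fderiv ℝ (cramerField H e b) x (Pi.single b 1) := by
        rw [integral_finsetSum _ fun b _ => i2 b, Finset.sum_neg_distrib]
    _ = 0 := by
        simp_rw [← Finset.mul_sum, sum_fderiv_cramerField hH e]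
        simp

theorem hasDerivAt_degreeIntegral {H : (ι → ℝ) → (ι → ℝ)} (hH : ContDiff ℝ ∞ H)
    (hp : BoundedPreimages H) {ψ : (ι → ℝ) → ℝ} (hψ : ContDiff ℝ ∞ ψ)
    (hc : HasCompactSupport ψ) (z e : ι → ℝ) (s₀ : ℝ) :
    HasDerivAt (fun s : ℝ => degreeIntegral H ψ (z + s • e)) 0 s₀ := by
  have hJ := continuous_det_fderiv hH
  have hdc : HasCompactSupport (fderiv ℝ ψ) := hc.fderiv ℝ
  have hdcont : Continuous (fderiv ℝ ψ) := hψ.continuous_fderiv (by simp)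
  obtain ⟨M, hM⟩ := hdc.exists_bound_of_continuous hdcont
  obtain ⟨R, hR⟩ := exists_bound_of_ne_zero hp hdc (‖z‖ + (|s₀| + 1) * ‖e‖)
  have h0 : ∫ x, -(fderiv ℝ ψ (H x - (z + s₀ • e)) e) * (fderiv ℝ H x).det = 0 := by
    simp_rw [neg_mul]
    rw [integral_neg, integral_fderiv_mul_det hH hp hψ hc, neg_zero]
  rw [← h0]
  refine (hasDerivAt_integral_of_dominated_loc_of_deriv_le
    (F := fun s x => ψ (H x - (z + s • e)) * (fderiv ℝ H x).det)
    (F' := fun s x => -(fderiv ℝ ψ (H x - (z + s • e)) e) * (fderiv ℝ H x).det)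
    (bound := (closedBall (0 : ι → ℝ) R).indicator fun x => M * ‖e‖ * |(fderiv ℝ H x).det|)
    (ball_mem_nhds s₀ one_pos) ?_ ?_ ?_ ?_ ?_ ?_).2
  · refine Filter.Eventually.of_forall fun s => Continuous.aestronglyMeasurable ?_
    exact (hψ.continuous.comp (hH.continuous.sub continuous_const)).mul hJ
  · refine Continuous.integrable_of_hasCompactSupport ?_ ?_
    · exact (hψ.continuous.comp (hH.continuous.sub continuous_const)).mul hJ
    · exact (hasCompactSupport_comp_sub hp hc _).mul_right
  · refine Continuous.aestronglyMeasurable ?_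
    exact ((hdcont.comp (hH.continuous.sub continuous_const)).clm_apply continuous_const).neg.mul hJ
  · refine Filter.Eventually.of_forall fun x s hs => ?_
    by_cases hx : x ∈ closedBall (0 : ι → ℝ) R
    · rw [Set.indicator_of_mem hx, norm_mul, norm_neg, Real.norm_eq_abs (_ : ℝ)]
      exact mul_le_mul_of_nonneg_right (((fderiv ℝ ψ _).le_opNorm e).trans
        (mul_le_mul_of_nonneg_right (hM _) (norm_nonneg e))) (abs_nonneg _)
    · rw [Set.indicator_of_notMem hx, hR x _ _ (by simpa using hx)]
      · simp
      · refine (norm_add_le _ _).trans ?_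
        rw [norm_smul]
        gcongr
        rw [mem_ball, Real.dist_eq] at hs
        rw [Real.norm_eq_abs]
        calc |s| = |s₀ + (s - s₀)| := by congr 1; ring
          _ ≤ |s₀| + |s - s₀| := abs_add_le _ _
          _ ≤ _ := by gcongr
  · rw [integrable_indicator_iff measurableSet_closedBall]
    exact (continuous_const.mul hJ.abs).continuousOn.integrableOn_compact (isCompact_closedBall _ _)
  · refine Filter.Eventually.of_forall fun x s _ => ?_
    refine HasDerivAt.mul_const ?_ _
    have h1 : HasDerivAt (fun s : ℝ => H x - (z + s • e)) (-e) s := by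
      simpa using (((hasDerivAt_id s).smul_const e).const_add z).const_sub (H x)
    have h2 : HasFDerivAt ψ (fderiv ℝ ψ (H x - (z + s • e))) (H x - (z + s • e)) :=
      (hψ.differentiable (by simp)).differentiableAt.hasFDerivAt
    have h3 := h2.comp_hasDerivAt s h1
    rw [map_neg] at h3
    exact h3

theorem degreeIntegral_eq {H : (ι → ℝ) → (ι → ℝ)} (hH : ContDiff ℝ ∞ H)
    (hp : BoundedPreimages H) {ψ : (ι → ℝ) → ℝ} (hψ : ContDiff ℝ ∞ ψ)
    (hc : HasCompactSupport ψ) (y z : ι → ℝ) : degreeIntegral H ψ y = degreeIntegral H ψ z := by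
  have h := fun s => hasDerivAt_degreeIntegral hH hp hψ hc y (z - y) s
  have := is_const_of_deriv_eq_zero (fun s => (h s).differentiableAt) (fun s => (h s).deriv) 0 1
  simpa using this

end DegreeIntegral

section DegreeCount

open scoped ContDiff Topology
open MeasureTheory Metric

variable {ι : Type*} [Fintype ι]

theorem sign_mul_abs_of_sign_eq {a b : ℝ} (h : SignType.sign b = SignType.sign a) :
    b = ((SignType.sign a : ℤ) : ℝ) * |b| := by
  rw [← h]
  rcases lt_trichotomy b 0 with h | h | h
  · simp [h, abs_of_neg]
  · simp [h]
  · simp [h, abs_of_pos]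

theorem exists_injOn_nhds {H : (ι → ℝ) → (ι → ℝ)} (hH : ContDiff ℝ ∞ H) {p : ι → ℝ}
    (hdet : (fderiv ℝ H p).det ≠ 0) :
    ∃ U : Set (ι → ℝ), IsOpen U ∧ p ∈ U ∧ Set.InjOn H U ∧
      (∀ x ∈ U, SignType.sign (fderiv ℝ H x).det = SignType.sign (fderiv ℝ H p).det) := by
  have h1 : HasStrictFDerivAt H
      (((fderiv ℝ H p).toContinuousLinearEquivOfDetNeZero hdet : (ι → ℝ) ≃L[ℝ] (ι → ℝ)) :
        (ι → ℝ) →L[ℝ] (ι → ℝ)) p := by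
    rw [ContinuousLinearMap.coe_toContinuousLinearEquivOfDetNeZero]
    exact (hH.contDiffAt).hasStrictFDerivAt (by simp)
  have h2 : ∀ᶠ x in 𝓝 p, SignType.sign (fderiv ℝ H x).det = SignType.sign (fderiv ℝ H p).det := by
    have hc := (continuous_det_fderiv hH).continuousAt (x := p)
    rcases hdet.lt_or_gt with h | h
    · filter_upwards [hc.eventually_lt_const h] with x hx
      rw [sign_neg hx, sign_neg h]
    · filter_upwards [hc.eventually_const_lt h] with x hx
      rw [sign_pos hx, sign_pos h]
  obtain ⟨W, hW, hWo, hpW⟩ := _root_.eventually_nhds_iff.1 h2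
  refine ⟨(h1.toOpenPartialHomeomorph H).source ∩ W,
    (h1.toOpenPartialHomeomorph H).open_source.inter hWo,
    ⟨h1.mem_toOpenPartialHomeomorph_source, hpW⟩, ?_, fun x hx => hW x hx.2⟩
  have := (h1.toOpenPartialHomeomorph H).injOn
  rw [h1.toOpenPartialHomeomorph_coe] at this
  exact this.mono Set.inter_subset_left

theorem image_mem_nhds_of_det_ne_zero {H : (ι → ℝ) → (ι → ℝ)} (hH : ContDiff ℝ ∞ H) {p : ι → ℝ}
    (hdet : (fderiv ℝ H p).det ≠ 0) {U : Set (ι → ℝ)} (hU : U ∈ 𝓝 p) : H '' U ∈ 𝓝 (H p) := by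
  have h1 : HasStrictFDerivAt H
      (((fderiv ℝ H p).toContinuousLinearEquivOfDetNeZero hdet : (ι → ℝ) ≃L[ℝ] (ι → ℝ)) :
        (ι → ℝ) →L[ℝ] (ι → ℝ)) p := by
    rw [ContinuousLinearMap.coe_toContinuousLinearEquivOfDetNeZero]
    exact (hH.contDiffAt).hasStrictFDerivAt (by simp)
  rw [← h1.map_nhds_eq_of_equiv]
  exact Filter.image_mem_map hU

theorem finite_preimage_of_regular {H : (ι → ℝ) → (ι → ℝ)} (hH : ContDiff ℝ ∞ H)
    (hp : BoundedPreimages H) {z : ι → ℝ} (hz : ∀ x, H x = z → (fderiv ℝ H x).det ≠ 0) :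
    (H ⁻¹' {z}).Finite := by
  have hcomp : IsCompact (H ⁻¹' {z}) := by
    obtain ⟨R, hR⟩ := hp ‖z‖
    refine (isCompact_closedBall (0 : ι → ℝ) R).of_isClosed_subset
      (isClosed_singleton.preimage hH.continuous) fun x hx => ?_
    have hx' : H x = z := hx
    simpa using hR x (by rw [hx'])
  refine hcomp.finite ?_
  rw [isDiscrete_iff_forall_mem_exists_isOpen]
  intro p hpz
  obtain ⟨U, hUo, hpU, hinj, -⟩ := exists_injOn_nhds hH (hz p hpz)
  refine ⟨U, hUo, ?_⟩
  ext x
  constructor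
  · rintro ⟨h1, h2⟩
    exact hinj h1 hpU ((h2 : H x = z).trans (hpz : H p = z).symm)
  · rintro rfl
    exact ⟨hpU, hpz⟩

theorem degreeIntegral_eq_sum_sign {H : (ι → ℝ) → (ι → ℝ)} (hH : ContDiff ℝ ∞ H)
    (hp : BoundedPreimages H) {z : ι → ℝ} (hz : ∀ x, H x = z → (fderiv ℝ H x).det ≠ 0)
    {s : Finset (ι → ℝ)} (hs : (s : Set (ι → ℝ)) = H ⁻¹' {z}) :
    ∃ δ > 0, ∀ ψ : (ι → ℝ) → ℝ, Continuous ψ → HasCompactSupport ψ →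
      Function.support ψ ⊆ ball 0 δ → ∫ x, ψ x = 1 →
      degreeIntegral H ψ z = ∑ x ∈ s, ((SignType.sign (fderiv ℝ H x).det : ℤ) : ℝ) := by
  have hmem : ∀ x, x ∈ s ↔ H x = z := fun x => by
    rw [← Finset.mem_coe, hs]; rfl
  obtain ⟨V, hV, hVd⟩ := s.finite_toSet.t2_separation
  have hU : ∀ p, ∃ U : Set (ι → ℝ), p ∈ s → IsOpen U ∧ p ∈ U ∧ Set.InjOn H U ∧
      (∀ x ∈ U, SignType.sign (fderiv ℝ H x).det = SignType.sign (fderiv ℝ H p).det) := by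
    intro p
    by_cases hps : p ∈ s
    · obtain ⟨U, h⟩ := exists_injOn_nhds hH (hz p ((hmem p).1 hps))
      exact ⟨U, fun _ => h⟩
    · exact ⟨∅, fun h => absurd h hps⟩
  choose U hU using hU
  set W : (ι → ℝ) → Set (ι → ℝ) := fun p => U p ∩ V p with hW
  have hWo : ∀ p ∈ s, IsOpen (W p) := fun p hps => (hU p hps).1.inter (hV p).2
  have hpW : ∀ p ∈ s, p ∈ W p := fun p hps => ⟨(hU p hps).2.1, (hV p).1⟩
  have hWd : (s : Set (ι → ℝ)).Pairwise (Function.onFun Disjoint W) := fun p hp q hq hpq =>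
    (hVd hp hq hpq).mono Set.inter_subset_right Set.inter_subset_right
  have hWi : ∀ p ∈ s, Set.InjOn H (W p) := fun p hps =>
    (hU p hps).2.2.1.mono Set.inter_subset_left
  have hopen : IsOpen (⋃ p ∈ s, W p) := isOpen_biUnion hWo
  -- a small ball around `z` whose preimage lies in the union of the neighbourhoods
  obtain ⟨δ₁, hδ₁, h1⟩ : ∃ δ > 0, ∀ x, H x ∈ ball z δ → x ∈ ⋃ p ∈ s, W p := by
    obtain ⟨R, hR⟩ := hp (‖z‖ + 1)
    have hK : IsCompact (H '' (closedBall 0 R \ ⋃ p ∈ s, W p)) :=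
      ((isCompact_closedBall _ _).diff hopen).image hH.continuous
    have hzK : z ∉ H '' (closedBall 0 R \ ⋃ p ∈ s, W p) := by
      rintro ⟨x, ⟨-, hx⟩, hxz⟩
      exact hx (Set.mem_biUnion ((hmem x).2 hxz) (hpW x ((hmem x).2 hxz)))
    obtain ⟨δ, hδ, hb⟩ := Metric.isOpen_iff.1 hK.isClosed.isOpen_compl z hzK
    refine ⟨min δ 1, lt_min hδ one_pos, fun x hx => ?_⟩
    by_contra hne
    refine hb (ball_subset_ball (min_le_left _ _) hx) ⟨x, ⟨?_, hne⟩, rfl⟩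
    have h2 : dist (H x) z < 1 := (mem_ball.1 hx).trans_le (min_le_right _ _)
    rw [mem_closedBall_zero_iff]
    refine hR x ?_
    rw [dist_eq_norm] at h2
    calc ‖H x‖ = ‖z + (H x - z)‖ := by congr 1; abel
      _ ≤ _ := (norm_add_le _ _).trans (by gcongr)
  obtain ⟨δ₂, hδ₂, h2⟩ : ∃ δ > 0, ball z δ ⊆ ⋂ p ∈ s, H '' W p := by
    refine Metric.mem_nhds_iff.1 ((Filter.biInter_finset_mem s).2 fun p hps => ?_)
    have := image_mem_nhds_of_det_ne_zero hH (hz p ((hmem p).1 hps))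
      ((hWo p hps).mem_nhds (hpW p hps))
    rwa [(hmem p).1 hps] at this
  refine ⟨min δ₁ δ₂, lt_min hδ₁ hδ₂, fun ψ hψ hψc hsupp hψint => ?_⟩
  have hzero : ∀ y, y ∉ ball z (min δ₁ δ₂) → ψ (y - z) = 0 := by
    intro y hy
    by_contra hne
    exact hy (by simpa [dist_eq_norm] using hsupp hne)
  have hcont : Continuous fun x => ψ (H x - z) * (fderiv ℝ H x).det :=
    (hψ.comp (hH.continuous.sub continuous_const)).mul (continuous_det_fderiv hH)
  have hI : Integrable fun x => ψ (H x - z) * (fderiv ℝ H x).det :=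
    hcont.integrable_of_hasCompactSupport (hasCompactSupport_comp_sub hp hψc z).mul_right
  rw [degreeIntegral, ← setIntegral_eq_integral_of_forall_compl_eq_zero (s := ⋃ p ∈ s, W p),
    integral_biUnion_finset s (fun p hps => (hWo p hps).measurableSet) hWd
      (fun p _ => hI.integrableOn)]
  · refine Finset.sum_congr rfl fun p hps => ?_
    have h3 : ∫ x in W p, ψ (H x - z) * (fderiv ℝ H x).det =
        ∫ x in W p, ((SignType.sign (fderiv ℝ H p).det : ℤ) : ℝ) *
          (|(fderiv ℝ H x).det| • ψ (H x - z)) := by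
      refine setIntegral_congr_fun (hWo p hps).measurableSet fun x hx => ?_
      have := sign_mul_abs_of_sign_eq ((hU p hps).2.2.2 x hx.1)
      simp only [smul_eq_mul]
      rw [← mul_assoc, ← this, mul_comm]
    rw [h3, integral_const_mul, ← integral_image_eq_integral_abs_det_fderiv_smul volume
      (hWo p hps).measurableSet (fun x _ => ((hH.differentiable (by simp)).differentiableAt
        (x := x)).hasFDerivAt.hasFDerivWithinAt) (hWi p hps) (fun y => ψ (y - z)),
      setIntegral_eq_integral_of_forall_compl_eq_zero, integral_sub_right_eq_self, hψint, mul_one]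
    intro y hy
    refine hzero y fun hyb => hy ?_
    exact Set.mem_iInter₂.1 (h2 (ball_subset_ball (min_le_right _ _) hyb)) p hps
  · intro x hx
    rw [hzero (H x) fun hxb => hx (h1 x (ball_subset_ball (min_le_left _ _) hxb)), zero_mul]

/-- The number of preimages of a regular value, counted with the sign of the Jacobian
determinant, does not depend on the regular value. -/
theorem sum_sign_det_eq {H : (ι → ℝ) → (ι → ℝ)} (hH : ContDiff ℝ ∞ H)
    (hp : BoundedPreimages H) {y z : ι → ℝ} (hy : ∀ x, H x = y → (fderiv ℝ H x).det ≠ 0)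
    (hz : ∀ x, H x = z → (fderiv ℝ H x).det ≠ 0) :
    ∑ᶠ x ∈ H ⁻¹' {y}, (SignType.sign (fderiv ℝ H x).det : ℤ) =
      ∑ᶠ x ∈ H ⁻¹' {z}, (SignType.sign (fderiv ℝ H x).det : ℤ) := by
  have fy := finite_preimage_of_regular hH hp hy
  have fz := finite_preimage_of_regular hH hp hz
  obtain ⟨δ₁, hδ₁, h1⟩ := degreeIntegral_eq_sum_sign hH hp hy fy.coe_toFinset
  obtain ⟨δ₂, hδ₂, h2⟩ := degreeIntegral_eq_sum_sign hH hp hz fz.coe_toFinset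
  have hδ : 0 < min δ₁ δ₂ := lt_min hδ₁ hδ₂
  let f : ContDiffBump (0 : ι → ℝ) := ⟨min δ₁ δ₂ / 2, min δ₁ δ₂, half_pos hδ, half_lt_self hδ⟩
  have hf := f.contDiff_normed (μ := (volume : Measure (ι → ℝ))) (n := ⊤)
  have hs : Function.support (f.normed volume) = ball 0 (min δ₁ δ₂) := f.support_normed_eq
  have e1 := h1 (f.normed volume) hf.continuous f.hasCompactSupport_normed
    (hs.subset.trans (ball_subset_ball (min_le_left _ _))) f.integral_normed
  have e2 := h2 (f.normed volume) hf.continuous f.hasCompactSupport_normed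
    (hs.subset.trans (ball_subset_ball (min_le_right _ _))) f.integral_normed
  rw [degreeIntegral_eq hH hp hf f.hasCompactSupport_normed y z, e2] at e1
  rw [finsum_mem_eq_finite_toFinset_sum _ fy, finsum_mem_eq_finite_toFinset_sum _ fz]
  exact_mod_cast e1.symm

end DegreeCount

section Linear

variable {ι : Type*} [Fintype ι]

theorem boundedPreimages_of_weightedHomogeneous {H : (ι → ℝ) → (ι → ℝ)} (hH : Continuous H)
    (a b : ι → ℕ) (ha : ∀ i, a i ≠ 0) (hb : ∀ j, b j ≠ 0)
    (hom : ∀ c : ℝ, 0 < c → ∀ (x : ι → ℝ) (j : ι), H (fun i => c ^ a i * x i) j = c ^ b j * H x j)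
    (h0 : ∀ x, H x = 0 → x = 0) : BoundedPreimages H := by
  intro R
  obtain ⟨c, hc, hcK⟩ : ∃ c > 0, ∀ s : ι → ℝ, ‖s‖ = 1 → c ≤ ‖H s‖ := by
    rcases (Metric.sphere (0 : ι → ℝ) 1).eq_empty_or_nonempty with h | h
    · refine ⟨1, one_pos, fun s hs => ?_⟩
      have : s ∈ Metric.sphere (0 : ι → ℝ) 1 := by simpa using hs
      simp [h] at this
    · obtain ⟨s₀, hs₀, hmin⟩ := (isCompact_sphere (0 : ι → ℝ) 1).exists_isMinOn h
        hH.norm.continuousOn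
      refine ⟨‖H s₀‖, norm_pos_iff.2 fun h => ?_, fun s hs => hmin (by simpa using hs)⟩
      rw [h0 s₀ h] at hs₀
      simp at hs₀
  refine ⟨(max 1 (R / c)) ^ ∑ i, a i, fun x hx => ?_⟩
  have h1 : (1 : ℝ) ≤ max 1 (R / c) := le_max_left _ _
  by_cases hx0 : x = 0
  · subst hx0; rw [norm_zero]; positivity
  obtain ⟨i₁, hi₁⟩ := Function.ne_iff.1 hx0
  obtain ⟨i₀, -, hmax⟩ := Finset.exists_max_image Finset.univ
    (fun i => |x i| ^ ((a i : ℝ)⁻¹)) ⟨i₁, Finset.mem_univ _⟩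
  set r : ℝ := |x i₀| ^ ((a i₀ : ℝ)⁻¹) with hr
  have hle : ∀ i, |x i| ≤ r ^ a i := fun i => by
    calc |x i| = (|x i| ^ ((a i : ℝ)⁻¹)) ^ a i := (Real.rpow_inv_natCast_pow (abs_nonneg _) (ha i)).symm
      _ ≤ r ^ a i := pow_le_pow_left₀ (by positivity) (hmax i (Finset.mem_univ _)) _
  have heq : |x i₀| = r ^ a i₀ := (Real.rpow_inv_natCast_pow (abs_nonneg _) (ha i₀)).symm
  have hr0 : 0 < r := by
    have h2 : 0 < |x i₁| := abs_pos.2 hi₁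
    exact (Real.rpow_pos_of_pos h2 _).trans_le (hmax i₁ (Finset.mem_univ _))
  set s : ι → ℝ := fun i => x i / r ^ a i with hs
  have hxs : x = fun i => r ^ a i * s i := by
    funext i
    simp only [hs]
    field_simp
  have hs1 : ‖s‖ = 1 := by
    apply le_antisymm
    · refine (pi_norm_le_iff_of_nonneg zero_le_one).2 fun i => ?_
      rw [Real.norm_eq_abs, hs, abs_div, abs_of_pos (pow_pos hr0 _)]
      exact div_le_one_of_le₀ (hle i) (by positivity)
    · have h3 : ‖s i₀‖ = 1 := by
        rw [Real.norm_eq_abs, hs, abs_div, abs_of_pos (pow_pos hr0 _), heq]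
        exact div_self (by positivity)
      rw [← h3]; exact norm_le_pi_norm s i₀
  have hrle : r ≤ max 1 (R / c) := by
    by_contra! hlt
    have hr1 : 1 < r := (le_max_left _ _).trans_lt hlt
    have h4 : ‖H s‖ ≤ R / r := by
      refine (pi_norm_le_iff_of_nonneg (div_nonneg ((norm_nonneg _).trans hx) hr0.le)).2 fun j => ?_
      rw [le_div_iff₀ hr0]
      calc ‖H s j‖ * r ≤ ‖H s j‖ * r ^ b j := by
            gcongr; exact le_self_pow₀ hr1.le (hb j)
        _ = ‖H x j‖ := by
            conv_rhs => rw [hxs, hom r hr0, norm_mul, norm_pow, Real.norm_of_nonneg hr0.le, mul_comm]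
        _ ≤ R := (norm_le_pi_norm _ j).trans hx
    have h5 : c * r ≤ R := (le_div_iff₀ hr0).1 ((hcK s hs1).trans h4)
    have h6 : r ≤ R / c := (le_div_iff₀ hc).2 (by linarith)
    exact absurd (h6.trans (le_max_right _ _)) (not_le.2 hlt)
  refine (pi_norm_le_iff_of_nonneg (by positivity)).2 fun i => ?_
  calc ‖x i‖ ≤ r ^ a i := hle i
    _ ≤ max 1 (R / c) ^ a i := pow_le_pow_left₀ hr0.le hrle _
    _ ≤ _ := pow_le_pow_right₀ h1 (Finset.single_le_sum (f := a) (fun _ _ => Nat.zero_le _)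
        (Finset.mem_univ i))

theorem det_mul_det_pos_of_segment_injective (f g : (ι → ℝ) →ₗ[ℝ] (ι → ℝ))
    (h : ∀ t : ℝ, 0 ≤ t → t ≤ 1 → ∀ v, (1 - t) • f v + t • g v = 0 → v = 0) :
    0 < LinearMap.det f * LinearMap.det g := by
  set F : ℝ → ℝ := fun t => LinearMap.det ((1 - t) • f + t • g) with hF
  have hcont : Continuous F := by
    simp only [hF, ← LinearMap.det_toMatrix', map_add, map_smul]
    exact Continuous.matrix_det (by fun_prop)
  have hne : ∀ t ∈ Set.Icc (0 : ℝ) 1, F t ≠ 0 := by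
    intro t ht hdet
    obtain ⟨v, hv, hv0⟩ := Submodule.exists_mem_ne_zero_of_ne_bot
      (LinearMap.bot_lt_ker_of_det_eq_zero hdet).ne'
    exact hv0 (h t ht.1 ht.2 v hv)
  have e0 : F 0 = LinearMap.det f := by simp [hF]
  have e1 : F 1 = LinearMap.det g := by simp [hF]
  rw [← e0, ← e1]
  by_contra! hle
  have : (0 : ℝ) ∈ Set.uIcc (F 0) (F 1) := by
    rw [Set.mem_uIcc]
    rcases le_total (F 0) 0 with h0 | h0
    · rcases le_or_gt 0 (F 1) with h1 | h1
      · exact Or.inl ⟨h0, h1⟩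
      · exact absurd (mul_pos_of_neg_of_neg (h0.lt_of_ne (hne 0 (by simp))) h1) (not_lt.2 hle)
    · rcases le_or_gt (F 1) 0 with h1 | h1
      · exact Or.inr ⟨h1, h0⟩
      · exact absurd (mul_pos (h0.lt_of_ne' (hne 0 (by simp))) h1) (not_lt.2 hle)
  obtain ⟨t, ht, hFt⟩ := intermediate_value_uIcc hcont.continuousOn this
  rw [Set.uIcc_of_le zero_le_one] at ht
  exact hne t ht hFt

end Linear

section Blocks

variable {κ : Type} {σ : κ → Type} [∀ i, Fintype (σ i)] {L : κ → ℕ}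

/-- The polynomial whose coefficients are the coordinates of `v` in the block `i`. -/
noncomputable def blockPoly (e : ∀ i, σ i ≃ Fin (L i)) (i : κ) :
    ((Σ i, σ i) ⊕ Unit → ℝ) →ₗ[ℝ] ℝ[X] :=
  ∑ p : σ i, (monomial (e i p : ℕ)).comp (LinearMap.proj (Sum.inl ⟨i, p⟩))

/-- The vector with the coefficients of `Z i` in the block `i` and the last coordinate `c`. -/
noncomputable def blockVec (e : ∀ i, σ i ≃ Fin (L i)) (Z : κ → ℝ[X]) (c : ℝ) :
    (Σ i, σ i) ⊕ Unit → ℝ :=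
  Sum.elim (fun q => (Z q.1).coeff (e q.1 q.2)) (fun _ => c)

variable (e : ∀ i, σ i ≃ Fin (L i))

theorem coeff_blockPoly (v : (Σ i, σ i) ⊕ Unit → ℝ) (i : κ) (p : σ i) :
    (blockPoly e i v).coeff (e i p) = v (Sum.inl ⟨i, p⟩) := by
  simp only [blockPoly, LinearMap.sum_apply, LinearMap.comp_apply, LinearMap.proj_apply,
    finsetSum_coeff, coeff_monomial]
  rw [Finset.sum_eq_single p]
  · simp
  · intro b _ hb
    rw [if_neg]
    intro h
    exact hb ((e i).injective (Fin.ext h))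
  · simp

theorem degree_blockPoly_lt (v : (Σ i, σ i) ⊕ Unit → ℝ) (i : κ) :
    (blockPoly e i v).degree < L i := by
  simp only [blockPoly, LinearMap.sum_apply, LinearMap.comp_apply, LinearMap.proj_apply]
  refine (degree_sum_le _ _).trans_lt ((Finset.sup_lt_iff (WithBot.bot_lt_coe _)).2 fun p _ => ?_)
  exact (degree_monomial_le _ _).trans_lt (by exact_mod_cast (e i p).2)

theorem blockPoly_blockVec (Z : κ → ℝ[X]) (c : ℝ) (i : κ) (hZ : (Z i).degree < L i) :
    blockPoly e i (blockVec e Z c) = Z i := by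
  ext j
  by_cases hj : j < L i
  · have := coeff_blockPoly e (blockVec e Z c) i ((e i).symm ⟨j, hj⟩)
    simpa [blockVec] using this
  · rw [coeff_eq_zero_of_degree_lt, coeff_eq_zero_of_degree_lt]
    · exact hZ.trans_le (by exact_mod_cast not_lt.1 hj)
    · exact (degree_blockPoly_lt e _ i).trans_le (by exact_mod_cast not_lt.1 hj)

theorem eq_zero_of_blockPoly_eq_zero {v : (Σ i, σ i) ⊕ Unit → ℝ}
    (h : ∀ i, blockPoly e i v = 0) (hc : v (Sum.inr ()) = 0) : v = 0 := by
  funext q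
  rcases q with ⟨i, p⟩ | ⟨⟩
  · rw [← coeff_blockPoly e v i p, h]; simp
  · exact hc

end Blocks

theorem eq_zero_of_alternating_recursion (g : ℕ → ℝ) (m : ℕ) (t : ℝ) (h0 : 0 ≤ t) (h1 : t ≤ 1)
    (hg : ∀ j < m, (1 - t) * g j + t * ((j + 1) * g (j + 1)) = 0)
    (hm : (1 - t) * ((-1) ^ m * g m) + t * g 0 = 0) : ∀ j ≤ m, g j = 0 := by
  rcases h1.lt_or_eq with h1 | rfl
  · have h1' : 0 < 1 - t := by linarith
    have key : ∀ j ≤ m, ∃ q : ℝ, 0 ≤ q ∧ g (m - j) = (-1) ^ j * q * g m := by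
      intro j
      induction j with
      | zero => exact fun _ => ⟨1, zero_le_one, by simp⟩
      | succ j ih =>
        intro hj
        obtain ⟨q, hq, hq'⟩ := ih (by omega)
        refine ⟨t / (1 - t) * ((m - (j + 1) : ℕ) + 1) * q, by positivity, ?_⟩
        have h2 := hg (m - (j + 1)) (by omega)
        rw [show m - (j + 1) + 1 = m - j by omega, hq'] at h2
        rw [pow_succ]
        field_simp
        linear_combination h2
    obtain ⟨q, hq, hq'⟩ := key m le_rfl
    rw [Nat.sub_self] at hq'
    have h3 : (-1 : ℝ) ^ m * (1 - t + t * q) * g m = 0 := by rw [hq'] at hm; linear_combination hm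
    have h4 : g m = 0 := by
      have : (-1 : ℝ) ^ m * (1 - t + t * q) ≠ 0 := by
        refine mul_ne_zero (pow_ne_zero _ (by norm_num)) (ne_of_gt ?_)
        have := mul_nonneg h0 hq
        linarith
      exact (mul_eq_zero.1 h3).resolve_left this
    intro j hj
    obtain ⟨q, -, h5⟩ := key (m - j) (Nat.sub_le _ _)
    rw [Nat.sub_sub_self hj, h4, mul_zero] at h5
    exact h5
  · intro j hj
    rcases j with _ | j
    · simpa using hm
    · have := hg j (by omega)
      have h2 : ((j : ℝ) + 1) ≠ 0 := by positivity
      simpa [h2] using this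

/-- The Chinese remainder theorem for `X ^ m` and zero residues. -/
theorem exists_partial_residue {κ : Type} [Fintype κ] (R : κ → ℝ[X]) (hR : ∀ i, (R i).Monic)
    (hco : Pairwise fun i j => IsCoprime (R i) (R j)) {m : ℕ}
    (hdeg : (∏ i, R i).natDegree = m) (j : κ) :
    ∃ B : ℝ[X], B.degree < m ∧ R j ∣ B - X ^ m ∧ ∀ i ≠ j, R i ∣ B := by
  have hmon : (∏ i, R i).Monic := monic_prod_of_monic _ _ fun i _ => hR i
  have hcop : IsCoprime (R j) (∏ i ∈ Finset.univ.erase j, R i) :=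
    IsCoprime.prod_right fun i hi => hco (Finset.ne_of_mem_erase hi).symm
  obtain ⟨a, b, hab⟩ := hcop
  set Z : ℝ[X] := b * (∏ i ∈ Finset.univ.erase j, R i) * X ^ m with hZ
  have hdvd : ∀ i, R i ∣ Z %ₘ (∏ i, R i) - Z := fun i => by
    have h1 := modByMonic_add_div Z (∏ i, R i)
    refine (Finset.dvd_prod_of_mem R (Finset.mem_univ i)).trans ⟨-(Z /ₘ ∏ i, R i), ?_⟩
    linear_combination h1
  refine ⟨Z %ₘ (∏ i, R i), ?_, ?_, fun i hi => ?_⟩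
  · have := degree_modByMonic_lt Z hmon
    rwa [degree_eq_natDegree hmon.ne_zero, hdeg] at this
  · have h2 : R j ∣ Z - X ^ m := ⟨-a * X ^ m, by rw [hZ]; linear_combination X ^ m * hab⟩
    have := dvd_add (hdvd j) h2
    rwa [sub_add_sub_cancel] at this
  · have h2 : R i ∣ Z := by
      rw [hZ]
      exact ((Finset.dvd_prod_of_mem R (Finset.mem_erase.2 ⟨hi, Finset.mem_univ _⟩)).mul_left b).mul_right _
    have := dvd_add (hdvd i) h2
    rwa [sub_add_cancel] at this

section RefMap

variable {κ : Type} [Fintype κ] {σ : κ → Type} [∀ i, Fintype (σ i)] {L : κ → ℕ}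
  (e : ∀ i, σ i ≃ Fin (L i))

/-- The leading coordinate of the block `i`. -/
noncomputable def blockLead (i : κ) : ((Σ i, σ i) ⊕ Unit → ℝ) →ₗ[ℝ] ℝ :=
  (lcoeff ℝ (L i - 1)).comp (blockPoly e i)

noncomputable def refPoly (G : κ → κ → ℝ[X]) (τ : ℝ) (i : κ) :
    ((Σ i, σ i) ⊕ Unit → ℝ) →ₗ[ℝ] ℝ[X] :=
  blockPoly e i - (monomial (L i - 1)).comp (blockLead e i) +
    τ • ∑ j, (blockLead e j).smulRight (G i j)

noncomputable def refConst (s : ℝ) (i : κ) : ((Σ i, σ i) ⊕ Unit → ℝ) →ₗ[ℝ] ℝ :=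
  s • blockLead e i - LinearMap.proj (Sum.inr ())

/-- A family of reference maps interpolating between a map which only depends on the block
sizes and the linearized equations with the leading terms dropped. -/
noncomputable def refMap (i₀ : κ) (s : ℝ) (G : κ → κ → ℝ[X]) (τ : ℝ) :
    ((Σ i, σ i) ⊕ Unit → ℝ) →ₗ[ℝ] ((Σ i, σ i) ⊕ Unit → ℝ) where
  toFun v := blockVec e (fun i => X * refPoly e G τ i v + C (refConst e s i v)) (blockLead e i₀ v)
  map_add' v w := by
    funext q
    rcases q with ⟨i, p⟩ | ⟨⟩
    · simp only [blockVec, Sum.elim_inl, map_add, Pi.add_apply, mul_add, coeff_add]; ring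
    · simp [blockVec]
  map_smul' c v := by
    funext q
    rcases q with ⟨i, p⟩ | ⟨⟩
    · simp only [blockVec, Sum.elim_inl, map_smul, Pi.smul_apply, mul_smul_comm, coeff_add,
        coeff_smul, smul_eq_mul, coeff_C, RingHom.id_apply, mul_add]
      split_ifs <;> simp
    · simp [blockVec]

variable {e} {i₀ : κ} {s : ℝ} {G : κ → κ → ℝ[X]} (hL : ∀ i, 1 ≤ L i)
  (hG : ∀ i j, (G i j).degree < (L i - 1 : ℕ))

theorem degree_X_mul_add_C_lt {Z : ℝ[X]} {l : ℕ} (hl : 1 ≤ l) (hZ : Z.degree < (l - 1 : ℕ))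
    (c : ℝ) : (X * Z + C c).degree < ((l : ℕ) : WithBot ℕ) := by
  refine (degree_lt_iff_coeff_zero _ _).2 fun j hj => ?_
  obtain ⟨j, rfl⟩ : ∃ i, j = i + 1 := ⟨j - 1, by omega⟩
  rw [coeff_add, coeff_X_mul, coeff_C_succ, add_zero]
  exact (degree_lt_iff_coeff_zero _ _).1 hZ j (by omega)

include hL hG

theorem degree_refPoly_lt (τ : ℝ) (i : κ) (v : (Σ i, σ i) ⊕ Unit → ℝ) :
    (refPoly e G τ i v).degree < (L i - 1 : ℕ) := by
  refine (degree_lt_iff_coeff_zero _ _).2 fun j hj => ?_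
  have h1 : ∀ j', (G i j').coeff j = 0 := fun j' =>
    (degree_lt_iff_coeff_zero _ _).1 (hG i j') j (by exact_mod_cast hj)
  have h2 : (blockPoly e i v - monomial (L i - 1) ((blockPoly e i v).coeff (L i - 1))).coeff j
      = 0 := by
    rw [coeff_sub, coeff_monomial]
    split_ifs with h
    · rw [h, sub_self]
    · rw [sub_zero, (degree_lt_iff_coeff_zero _ _).1 (degree_blockPoly_lt e v i) j]
      have := hL i
      omega
  simp [refPoly, blockLead, h1] at h2 ⊢
  exact h2

theorem refMap_spec (τ : ℝ) (v : (Σ i, σ i) ⊕ Unit → ℝ) :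
    (∀ i, blockPoly e i (refMap e i₀ s G τ v) = X * refPoly e G τ i v + C (refConst e s i v)) ∧
    refMap e i₀ s G τ v (Sum.inr ()) = blockLead e i₀ v :=
  ⟨fun i => blockPoly_blockVec e (fun i => X * refPoly e G τ i v + C (refConst e s i v)) _ i
    (degree_X_mul_add_C_lt (hL i) (degree_refPoly_lt hL hG τ i v) _), rfl⟩

theorem refMap_injective (hs : s ≠ 0) (τ : ℝ) {v : (Σ i, σ i) ⊕ Unit → ℝ}
    (h : refMap e i₀ s G τ v = 0) : v = 0 := by
  obtain ⟨h1, h2⟩ := refMap_spec (i₀ := i₀) (s := s) (e := e) hL hG τ v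
  rw [h] at h1 h2
  have hν : blockLead e i₀ v = 0 := h2.symm
  have hpoly : ∀ i, X * refPoly e G τ i v + C (refConst e s i v) = 0 := fun i => by
    rw [← h1 i, map_zero]
  have hk : ∀ i, refConst e s i v = 0 := fun i => by
    simpa using congrArg (fun f => coeff f 0) (hpoly i)
  have hE : ∀ i, refPoly e G τ i v = 0 := fun i => by
    have := hpoly i
    rw [hk i, C_0, add_zero] at this
    exact (mul_eq_zero.1 this).resolve_left X_ne_zero
  have hc : v (Sum.inr ()) = 0 := by simpa [refConst, hν] using hk i₀
  have hl : ∀ i, blockLead e i v = 0 := fun i => by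
    simpa [refConst, hc, hs] using hk i
  exact eq_zero_of_blockPoly_eq_zero e (fun i => by simpa [refPoly, hl] using hE i) hc

theorem det_refMap_mul_pos (hs : s ≠ 0) :
    0 < LinearMap.det (refMap e i₀ s G 1) * LinearMap.det (refMap e i₀ s G 0) := by
  refine det_mul_det_pos_of_segment_injective _ _ fun t _ _ v hv => ?_
  refine refMap_injective (i₀ := i₀) (s := s) (e := e) hL hG hs (1 - t) ?_
  rw [← hv]
  funext q
  rcases q with ⟨i, p⟩ | ⟨⟩
  · have h1 : X * refPoly e G (1 - t) i v + C (refConst e s i v) =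
        (1 - t) • (X * refPoly e G 1 i v + C (refConst e s i v)) +
          t • (X * refPoly e G 0 i v + C (refConst e s i v)) := by
      simp only [refPoly, LinearMap.add_apply, LinearMap.smul_apply, smul_eq_C_mul, C_sub, C_1,
        C_0]
      ring
    change (X * refPoly e G (1 - t) i v + C (refConst e s i v)).coeff _ = _
    rw [h1, coeff_add, coeff_smul, coeff_smul]
    rfl
  · simp [refMap, blockVec]
    ring

end RefMap

section LinearizedSystem

variable {κ : Type} {σ : κ → Type} [∀ i, Fintype (σ i)] {L : κ → ℕ}
  {e : ∀ i, σ i ≃ Fin (L i)}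

theorem coeff_mul_blockPoly_of_monic {R : ℝ[X]} (hR : R.Monic) (i : κ) {m : ℕ}
    (hm : R.natDegree + L i = m + 1) (hL : 1 ≤ L i) (v : (Σ i, σ i) ⊕ Unit → ℝ) :
    (R * blockPoly e i v).coeff m = blockLead e i v := by
  obtain rfl : m = R.natDegree + (L i - 1) := by omega
  rw [coeff_mul_add_eq_of_natDegree_le le_rfl, hR.coeff_natDegree, one_mul]
  · rfl
  · refine natDegree_le_iff_coeff_eq_zero.2 fun N hN => ?_
    exact (degree_lt_iff_coeff_zero _ _).1 (degree_blockPoly_lt e v i) N (by omega)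


/-- The linearized equations have, up to a positive factor, the same determinant as a reference
map which only depends on the sizes of the blocks. -/
theorem det_mul_det_refMap_pos [Fintype κ] {m : ℕ} (hL : ∀ i, 1 ≤ L i) (i₀ : κ) (R : κ → ℝ[X])
    (hR : ∀ i, (R i).Monic) (hco : Pairwise fun i j => IsCoprime (R i) (R j))
    (hdeg : (∏ i, R i).natDegree = m) (hm : ∀ i, (R i).natDegree + L i = m + 1)
    (M : ((Σ i, σ i) ⊕ Unit → ℝ) →ₗ[ℝ] ((Σ i, σ i) ⊕ Unit → ℝ))
    (hM : ∀ v, ∃ Y : ℝ[X], Y.degree < m ∧ (∀ i, ∃ E : ℝ[X],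
        R i * E = derivative (R i * blockPoly e i v) - Y ∧
        blockPoly e i (M v) = X * E + C ((R i * blockPoly e i v).coeff 0 - v (Sum.inr ()))) ∧
      M v (Sum.inr ()) = blockLead e i₀ v) :
    0 < LinearMap.det M * LinearMap.det (refMap e i₀ ((-1) ^ m) 0 0) := by
  have hs : ((-1 : ℝ) ^ m) ≠ 0 := pow_ne_zero _ (by norm_num)
  choose B hBdeg hBj hBi using exists_partial_residue R hR hco hdeg
  have hG : ∀ i j, ∃ G : ℝ[X], G.degree < (L i - 1 : ℕ) ∧
      R i * G = B j + if i = j then R i * X ^ (L i - 1) - X ^ m else 0 := by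
    intro i j
    have hdvd : R i ∣ B j + if i = j then R i * X ^ (L i - 1) - X ^ m else 0 := by
      split_ifs with h
      · subst h
        have := dvd_add (hBj i) (dvd_mul_right (R i) (X ^ (L i - 1)))
        rwa [show B i + (R i * X ^ (L i - 1) - X ^ m) = B i - X ^ m + R i * X ^ (L i - 1) by ring]
      · simpa using hBi j i h
    obtain ⟨G, hG⟩ := hdvd
    refine ⟨G, ?_, hG.symm⟩
    have hlt : (B j + if i = j then R i * X ^ (L i - 1) - X ^ m else 0).degree < m := by
      refine (degree_add_le _ _).trans_lt (max_lt (hBdeg j) ?_)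
      split_ifs with h
      · have hmon : (R i * X ^ (L i - 1)).Monic := (hR i).mul (monic_X_pow _)
        have hd : (R i * X ^ (L i - 1)).degree = (m : WithBot ℕ) := by
          rw [degree_eq_natDegree hmon.ne_zero, (hR i).natDegree_mul (monic_X_pow _),
            natDegree_X_pow]
          have := hm i; have := hL i
          congr 1; omega
        have := degree_sub_lt_left (hd.trans (degree_X_pow m).symm) hmon.ne_zero (by
          rw [hmon.leadingCoeff, leadingCoeff_X_pow])
        rwa [hd] at this
      · simp
    rw [hG, degree_mul, degree_eq_natDegree (hR i).ne_zero] at hlt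
    have h1 : (m : WithBot ℕ) = ((R i).natDegree : WithBot ℕ) + ((L i - 1 : ℕ) : WithBot ℕ) := by
      have := hm i; have := hL i
      norm_cast
      omega
    rw [h1] at hlt
    exact lt_of_add_lt_add_left hlt
  choose G hGdeg hG using hG
  have hGsum : ∀ v i, R i * refPoly e G 1 i v = R i * blockPoly e i v -
      C (blockLead e i v) * X ^ m + ∑ j, C (blockLead e j v) * B j := by
    intro v i
    have h1 : R i * ∑ j, C (blockLead e j v) * G i j = ∑ j, C (blockLead e j v) * B j +
        C (blockLead e i v) * (R i * X ^ (L i - 1) - X ^ m) := by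
      rw [Finset.mul_sum]
      have : ∀ j, R i * (C (blockLead e j v) * G i j) = C (blockLead e j v) * B j +
          if i = j then C (blockLead e j v) * (R i * X ^ (L i - 1) - X ^ m) else 0 := fun j => by
        rw [mul_left_comm, hG, mul_add]
        split_ifs <;> simp
      simp_rw [this, Finset.sum_add_distrib]
      simp
    simp only [refPoly, LinearMap.add_apply, LinearMap.sub_apply, one_smul, LinearMap.comp_apply,
      LinearMap.sum_apply, LinearMap.smulRight_apply, smul_eq_C_mul, mul_add, mul_sub, h1]
    rw [← C_mul_X_pow_eq_monomial]
    ring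
  have key : 0 < LinearMap.det M * LinearMap.det (refMap e i₀ ((-1) ^ m) G 1) := by
    rw [mul_comm]
    refine det_mul_det_pos_of_segment_injective _ _ fun t ht0 ht1 v hv => ?_
    obtain ⟨Y, hY, hE, hν⟩ := hM v
    choose E hE hME using hE
    obtain ⟨h1, h2⟩ := refMap_spec (i₀ := i₀) (s := (-1) ^ m) (e := e) hL hGdeg 1 v
    have hc : blockLead e i₀ v = 0 := by
      have := congrFun hv (Sum.inr ())
      simp only [Pi.add_apply, Pi.smul_apply, h2, hν, smul_eq_mul, Pi.zero_apply] at this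
      linarith
    have hpoly : ∀ i, C (1 - t) * (X * refPoly e G 1 i v + C (refConst e ((-1) ^ m) i v)) +
        C t * (X * E i + C ((R i * blockPoly e i v).coeff 0 - v (Sum.inr ()))) = 0 := fun i => by
      have := congrArg (blockPoly e i) hv
      simpa only [map_add (blockPoly e i), map_smul (blockPoly e i), map_zero, h1, hME,
        smul_eq_C_mul] using this
    have hk : ∀ i, (1 - t) * refConst e ((-1) ^ m) i v +
        t * ((R i * blockPoly e i v).coeff 0 - v (Sum.inr ())) = 0 := fun i => by
      have := congrArg (fun f => coeff f 0) (hpoly i)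
      simpa only [coeff_add, coeff_C_mul, mul_coeff_zero, coeff_X_zero, zero_mul, zero_add,
        coeff_C_zero, coeff_zero] using this
    have hP : ∀ i, C (1 - t) * refPoly e G 1 i v + C t * E i = 0 := fun i => by
      have h3 : X * (C (1 - t) * refPoly e G 1 i v + C t * E i) = 0 := by
        have h4 := congrArg C (hk i)
        rw [C_add, C_mul, C_mul, C_0] at h4
        linear_combination hpoly i - h4
      exact (mul_eq_zero.1 h3).resolve_left X_ne_zero
    have hf : ∀ i, C (1 - t) * (R i * blockPoly e i v - C (blockLead e i v) * X ^ m +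
        ∑ j, C (blockLead e j v) * B j) + C t * (derivative (R i * blockPoly e i v) - Y) = 0 :=
      fun i => by
        rw [← hGsum, ← hE]
        linear_combination R i * hP i
    have htop : ∀ i, (R i * blockPoly e i v).coeff m = blockLead e i v := fun i =>
      coeff_mul_blockPoly_of_monic (hR i) i (hm i) (hL i) v
    have hhigh : ∀ i j, m < j → (R i * blockPoly e i v).coeff j = 0 := fun i j hj => by
      refine (degree_lt_iff_coeff_zero _ (m + 1)).1 ?_ j (by omega)
      rw [degree_mul, degree_eq_natDegree (hR i).ne_zero, ← hm i, Nat.cast_add]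
      exact WithBot.add_lt_add_left (by simp) (degree_blockPoly_lt e v i)
    have hall : ∀ i, R i * blockPoly e i v = R i₀ * blockPoly e i₀ v := by
      intro i
      set g := R i * blockPoly e i v - R i₀ * blockPoly e i₀ v with hg
      have h3 : C (1 - t) * (g - C (blockLead e i v) * X ^ m) + C t * derivative g = 0 := by
        have h4 := hf i₀
        rw [hc, C_0] at h4
        rw [hg, derivative_sub]
        linear_combination hf i - h4
      have h5 : ∀ j ≤ m, g.coeff j = 0 := by
        refine eq_zero_of_alternating_recursion g.coeff m t ht0 ht1 (fun j hj => ?_) ?_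
        · have := congrArg (fun f => coeff f j) h3
          simp only [coeff_add, coeff_C_mul, coeff_sub, coeff_X_pow, coeff_derivative,
            if_neg hj.ne, coeff_zero] at this
          linear_combination this
        · have h6 := hk i
          have h7 := hk i₀
          simp only [refConst, LinearMap.sub_apply, LinearMap.smul_apply, smul_eq_mul,
            LinearMap.proj_apply, hc] at h6 h7
          rw [hg, coeff_sub, coeff_sub, htop, htop, hc]
          linear_combination h6 - h7
      have h8 : g = 0 := by
        ext j
        rcases le_or_gt j m with hj | hj
        · simpa using h5 j hj
        · rw [hg, coeff_sub, hhigh _ _ hj, hhigh _ _ hj]; simp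
      exact sub_eq_zero.1 h8
    have hzero : R i₀ * blockPoly e i₀ v = 0 := by
      by_contra hne
      have hdvd : (∏ i, R i) ∣ R i₀ * blockPoly e i₀ v :=
        Finset.prod_dvd_of_coprime (fun i _ j _ hij => hco hij) fun i _ => by
          rw [← hall i]; exact dvd_mul_right _ _
      have h3 := natDegree_le_of_dvd hdvd hne
      have h4 : (R i₀ * blockPoly e i₀ v).degree < m := by
        refine (degree_lt_iff_coeff_zero _ _).2 fun j hj => ?_
        rcases (show m ≤ j from hj).eq_or_lt with rfl | hj
        · rw [htop, hc]
        · exact hhigh _ _ hj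
      rw [degree_eq_natDegree hne, Nat.cast_lt] at h4
      omega
    have hb : ∀ i, blockPoly e i v = 0 := fun i =>
      (mul_eq_zero.1 ((hall i).trans hzero)).resolve_left (hR i).ne_zero
    refine eq_zero_of_blockPoly_eq_zero e hb ?_
    have h3 := hk i₀
    simp only [refConst, LinearMap.sub_apply, LinearMap.smul_apply, smul_eq_mul,
      LinearMap.proj_apply, hc, hb, mul_zero, coeff_zero] at h3
    linarith
  have key2 := det_refMap_mul_pos (i₀ := i₀) (e := e) hL hGdeg hs
  have h3 : refMap e i₀ ((-1) ^ m) G 0 = refMap e i₀ ((-1) ^ m) 0 0 := by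
    ext v q
    rcases q with ⟨i, p⟩ | ⟨⟩ <;> simp [refMap, blockVec, refPoly]
  rw [h3] at key2
  have h4 := mul_pos key key2
  have h5 : 0 < LinearMap.det (refMap e i₀ ((-1) ^ m) G 1) ^ 2 := by
    have : LinearMap.det (refMap e i₀ ((-1) ^ m) G 1) ≠ 0 := fun h => by simp [h] at key
    positivity
  by_contra! hle
  have h6 := mul_nonpos_of_nonpos_of_nonneg hle h5.le
  linarith

end LinearizedSystem

section BlockVandermonde

theorem det_of_sigma_block {o : Type*} [Fintype o] [LinearOrder o] {α : o → Type*}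
    [∀ i, Fintype (α i)] [∀ i, DecidableEq (α i)] [DecidableEq (Σ i, α i)]
    {R : Type*} [CommRing R]
    (M : Matrix (Σ i, α i) (Σ i, α i) R) (N : ∀ i, Matrix (α i) (α i) R)
    (h0 : ∀ s t, s.1 ≠ t.1 → M s t = 0) (h1 : ∀ i a b, M ⟨i, a⟩ ⟨i, b⟩ = N i a b) :
    M.det = ∏ i, (N i).det := by
  have hb : M.BlockTriangular Sigma.fst := fun s t h => h0 s t (ne_of_gt h)
  rw [hb.det_fintype]
  refine Finset.prod_congr rfl fun i _ => ?_
  let f : α i ≃ {s : Σ i, α i // s.1 = i} := (Equiv.sigmaSubtype i).symm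
  rw [← Matrix.det_submatrix_equiv_self f]
  congr 1
  ext a b
  exact h1 i a b

variable {N : ℕ} {l : Fin N → ℕ} {L : ℕ} {e : (Σ m, Fin (l m)) ≃ Fin L}

/-- The matrix of coefficients of the polynomials `(m + 1) X ^ j ∏_{m' ≠ m} Q_{m'}`. -/
noncomputable def blockMatrix {K : Type*} [CommRing K] (e : (Σ m, Fin (l m)) ≃ Fin L)
    (Q : Fin N → K[X]) : Matrix (Σ m, Fin (l m)) (Σ m, Fin (l m)) K :=
  Matrix.of fun p s => (C ((s.1 : K) + 1) * X ^ (s.2 : ℕ) * ∏ m ∈ {s.1}ᶜ, Q m).coeff (e p)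

theorem det_vandermonde_sigma {K : Type*} [CommRing K] (r : (Σ m, Fin (l m)) → K)
    (he : ∀ s t, e s < e t ↔ s.1 < t.1 ∨ (s.1 = t.1 ∧ (s.2 : ℕ) < t.2)) :
    (Matrix.of fun s p : (Σ m, Fin (l m)) => r s ^ (e p : ℕ)).det =
      (∏ m, (Matrix.vandermonde fun j => r ⟨m, j⟩).det) *
        ∏ m, ∏ m' > m, ∏ j' : Fin (l m'), ∏ j : Fin (l m), (r ⟨m', j'⟩ - r ⟨m, j⟩) := by
  have h1 : (Matrix.of fun s p : (Σ m, Fin (l m)) => r s ^ (e p : ℕ)) =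
      (Matrix.vandermonde (r ∘ e.symm)).submatrix e e := by
    ext s p; simp [Matrix.vandermonde_apply]
  rw [h1, Matrix.det_submatrix_equiv_self, Matrix.det_vandermonde]
  have h2 : (∏ i : Fin L, ∏ j > i, ((r ∘ e.symm) j - (r ∘ e.symm) i)) =
      ∏ s, ∏ t, if e s < e t then r t - r s else 1 := by
    rw [← Equiv.prod_comp e]
    refine Finset.prod_congr rfl fun s _ => ?_
    have h3 : (Finset.Ioi (e s)) = Finset.univ.filter fun j => e s < j := by ext; simp
    rw [h3, Finset.prod_filter, ← Equiv.prod_comp e]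
    simp
  rw [h2, Fintype.prod_sigma, ← Finset.prod_mul_distrib]
  refine Finset.prod_congr rfl fun m _ => ?_
  have h4 : ∀ j : Fin (l m), (∏ t, if e ⟨m, j⟩ < e t then r t - r ⟨m, j⟩ else 1) =
      (∏ j' > j, (r ⟨m, j'⟩ - r ⟨m, j⟩)) * ∏ m' > m, ∏ j', (r ⟨m', j'⟩ - r ⟨m, j⟩) := by
    intro j
    rw [Fintype.prod_sigma]
    have h5 : ∀ m', (∏ j', if e ⟨m, j⟩ < e ⟨m', j'⟩ then r ⟨m', j'⟩ - r ⟨m, j⟩ else 1) =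
        (if m' = m then ∏ j' > j, (r ⟨m, j'⟩ - r ⟨m, j⟩) else 1) *
          if m < m' then ∏ j', (r ⟨m', j'⟩ - r ⟨m, j⟩) else 1 := by
      intro m'
      simp only [he]
      rcases lt_trichotomy m m' with h | rfl | h
      · simp [h, h.ne']
      · have h3 : (Finset.Ioi j) = Finset.univ.filter fun i => j < i := by ext; simp
        simp [h3, Finset.prod_filter]
      · simp [h.ne, h.ne', h.not_gt]
    simp only [h5, Finset.prod_mul_distrib, Finset.prod_ite_eq', Finset.mem_univ, if_true]
    congr 1
    rw [← Finset.prod_filter]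
    congr 1
    ext; simp
  simp only [h4, Finset.prod_mul_distrib, Matrix.det_vandermonde]
  congr 1
  rw [Finset.prod_comm]
  exact Finset.prod_congr rfl fun m' _ => Finset.prod_comm

theorem det_blockMatrix {K : Type*} [Field K] (r : (Σ m, Fin (l m)) → K)
    (hr : Function.Injective r)
    (he : ∀ s t, e s < e t ↔ s.1 < t.1 ∨ (s.1 = t.1 ∧ (s.2 : ℕ) < t.2)) :
    (blockMatrix e fun m => ∏ j, (X - C (r ⟨m, j⟩))).det =
      (∏ s : (Σ m, Fin (l m)), ((s.1 : K) + 1)) *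
        ∏ m, ∏ m' > m, ∏ j' : Fin (l m'), ∏ j : Fin (l m), (r ⟨m, j⟩ - r ⟨m', j'⟩) := by
  set Q : Fin N → K[X] := fun m => ∏ j, (X - C (r ⟨m, j⟩)) with hQ
  obtain ⟨W, hWr⟩ : ∃ W : Matrix (Σ m, Fin (l m)) (Σ m, Fin (l m)) K,
    W = Matrix.of fun s p => r s ^ (e p : ℕ) := ⟨_, rfl⟩
  have hcard : ∑ m, l m = L := by
    have := Fintype.card_congr e
    simpa [Fintype.card_sigma] using this
  have hmonic : ∀ m, (Q m).Monic := fun m => monic_prod_of_monic _ _ fun j _ => monic_X_sub_C _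
  have hdegQ : ∀ m, (Q m).natDegree = l m := fun m => by
    simp [hQ, natDegree_prod_of_monic _ _ fun j _ => monic_X_sub_C (r ⟨m, j⟩)]
  have hdeg : ∀ s : (Σ m, Fin (l m)), (C ((s.1 : K) + 1) * X ^ (s.2 : ℕ) *
      ∏ m ∈ {s.1}ᶜ, Q m).natDegree < L := by
    intro s
    have h1 : (∏ m ∈ {s.1}ᶜ, Q m).natDegree = ∑ m ∈ {s.1}ᶜ, l m := by
      rw [natDegree_prod_of_monic _ _ fun m _ => hmonic m]
      exact Finset.sum_congr rfl fun m _ => hdegQ m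
    have h2 : l s.1 + ∑ m ∈ {s.1}ᶜ, l m = L := by rw [← hcard, Fintype.sum_eq_add_sum_compl s.1]
    refine natDegree_mul_le.trans_lt ?_
    have h3 := natDegree_C_mul_X_pow_le ((s.1 : K) + 1) (s.2 : ℕ)
    have h4 := s.2.2
    omega
  have hmul : ∀ s t, (W * blockMatrix e Q) s t = (C ((t.1 : K) + 1) * X ^ (t.2 : ℕ) *
      ∏ m ∈ {t.1}ᶜ, Q m).eval (r s) := by
    intro s t
    rw [eval_eq_sum_range' (hdeg t), Matrix.mul_apply, Finset.sum_range, ← Equiv.sum_comp e]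
    refine Finset.sum_congr rfl fun p _ => ?_
    simp [hWr, blockMatrix, mul_comm]
  have hW := det_vandermonde_sigma r he
  rw [← hWr] at hW
  have hdet : (W * blockMatrix e Q).det = (∏ s : (Σ m, Fin (l m)), ((s.1 : K) + 1) *
      ∏ m ∈ {s.1}ᶜ, (Q m).eval (r s)) * ∏ m, (Matrix.vandermonde fun j => r ⟨m, j⟩).det := by
    have h1 : W * blockMatrix e Q = Matrix.diagonal (fun s => ((s.1 : K) + 1) *
        ∏ m ∈ {s.1}ᶜ, (Q m).eval (r s)) *
          Matrix.of fun s t => if s.1 = t.1 then r s ^ (t.2 : ℕ) else 0 := by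
      ext s t
      rw [hmul, Matrix.diagonal_mul, Matrix.of_apply]
      split_ifs with h
      · obtain ⟨m, j⟩ := s
        obtain ⟨m', j'⟩ := t
        obtain rfl : m = m' := h
        rw [eval_mul, eval_mul, eval_C, eval_pow, eval_X, eval_prod]; ring
      · rw [eval_mul, eval_prod, Finset.prod_eq_zero (i := s.1)]
        · simp
        · simpa using h
        · obtain ⟨m, j⟩ := s
          simp only [hQ, eval_prod]
          exact Finset.prod_eq_zero (Finset.mem_univ j) (by simp)
    rw [h1, Matrix.det_mul, Matrix.det_diagonal]
    congr 1
    refine det_of_sigma_block (α := fun m => Fin (l m)) _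
      (fun m => Matrix.vandermonde fun j => r ⟨m, j⟩) (fun s t h => ?_) fun i a b => ?_
    · simp [h]
    · simp [Matrix.vandermonde_apply]
  have hcross : ∀ m, ∀ m' > m, ∀ j' : Fin (l m'), ∀ j : Fin (l m), r ⟨m', j'⟩ - r ⟨m, j⟩ ≠ 0 := by
    intro m m' hm j' j
    refine sub_ne_zero.2 fun h => ?_
    exact (ne_of_gt hm) (congrArg Sigma.fst (hr h))
  have hW0 : W.det ≠ 0 := by
    rw [hW]
    refine mul_ne_zero (Finset.prod_ne_zero_iff.2 fun m _ => ?_) ?_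
    · rw [Matrix.det_vandermonde_ne_zero_iff]
      intro a b h
      simpa using hr h
    · simp only [Finset.prod_ne_zero_iff]
      exact fun m _ m' hm j' _ j _ => hcross m m' (Finset.mem_Ioi.1 hm) j' j
  refine mul_left_cancel₀ hW0 ?_
  rw [← Matrix.det_mul, hdet, hW, Finset.prod_mul_distrib]
  have h6 : ∏ s : (Σ m, Fin (l m)), ∏ m ∈ {s.1}ᶜ, (Q m).eval (r s) =
      (∏ m, ∏ m' > m, ∏ j' : Fin (l m'), ∏ j : Fin (l m), (r ⟨m', j'⟩ - r ⟨m, j⟩)) *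
      ∏ m, ∏ m' > m, ∏ j' : Fin (l m'), ∏ j : Fin (l m), (r ⟨m, j⟩ - r ⟨m', j'⟩) := by
    rw [Fintype.prod_sigma, ← Finset.prod_mul_distrib]
    have h7 := Finset.prod_prod_Ioi_mul_eq_prod_prod_off_diag
      (fun m m' : Fin N => ∏ j' : Fin (l m'), ∏ j : Fin (l m), (r ⟨m', j'⟩ - r ⟨m, j⟩))
    refine Eq.trans ?_ (Eq.trans h7.symm ?_)
    · refine Finset.prod_congr rfl fun m' _ => ?_
      change ∏ y : Fin (l m'), ∏ m ∈ {m'}ᶜ, eval (r ⟨m', y⟩) (Q m) = _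
      rw [Finset.prod_comm]
      refine Finset.prod_congr rfl fun m _ => Finset.prod_congr rfl fun j' _ => ?_
      simp [hQ, eval_prod]
    · refine Finset.prod_congr rfl fun m _ => ?_
      rw [← Finset.prod_mul_distrib]
      refine Finset.prod_congr rfl fun m' _ => ?_
      rw [mul_comm]
      congr 1
      exact Finset.prod_comm
  rw [h6]
  ring

end BlockVandermonde

section RealSign

open ComplexConjugate

theorem prod_eq_pos_mul_prod_fixed {β : Type*} (τ : β → β) (hτ : ∀ x, τ (τ x) = x) (f : β → ℂ)
    (hf : ∀ x, f (τ x) = conj (f x)) (S : Finset β) (hS : ∀ x ∈ S, τ x ∈ S)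
    (h0 : ∀ x ∈ S, f x ≠ 0) :
    ∃ c : ℝ, 0 < c ∧ ∏ x ∈ S, f x = c * ∏ x ∈ S with τ x = x, f x := by
  induction S using Finset.strongInduction with
  | H S ih =>
    by_cases h : ∀ x ∈ S, τ x = x
    · exact ⟨1, one_pos, by rw [Finset.filter_true_of_mem h]; simp⟩
    push Not at h
    obtain ⟨x, hx, hne⟩ := h
    have hx' : τ x ∈ S.erase x := Finset.mem_erase.2 ⟨hne, hS x hx⟩
    obtain ⟨c, hc, hprod⟩ := ih ((S.erase x).erase (τ x))
      ((Finset.erase_subset _ _).trans_ssubset (Finset.erase_ssubset hx))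
      (fun y hy => by
        simp only [Finset.mem_erase] at hy ⊢
        exact ⟨fun h => hy.2.1 (by rw [← hτ y, h, hτ]), fun h => hy.1 (by rw [← h, hτ]),
          hS y hy.2.2⟩)
      (fun y hy => h0 y (Finset.mem_of_mem_erase (Finset.mem_of_mem_erase hy)))
    refine ⟨Complex.normSq (f x) * c, mul_pos (Complex.normSq_pos.2 (h0 x hx)) hc, ?_⟩
    have hfilter : (((S.erase x).erase (τ x)).filter fun y => τ y = y) =
        S.filter fun y => τ y = y := by
      ext y
      simp only [Finset.mem_filter, Finset.mem_erase]
      refine ⟨fun h => ⟨h.1.2.2, h.2⟩, fun h => ⟨⟨?_, ?_, h.1⟩, h.2⟩⟩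
      · rintro rfl
        rw [hτ] at h
        exact hne h.2.symm
      · rintro rfl
        exact hne h.2
    rw [← Finset.mul_prod_erase S f hx, ← Finset.mul_prod_erase _ f hx', hprod, hfilter, hf,
      ← mul_assoc, Complex.mul_conj]
    push_cast
    ring

theorem prod_prod_sub_eq (A B : Finset ℂ) (hA : ∀ a ∈ A, conj a ∈ A) (hB : ∀ b ∈ B, conj b ∈ B)
    (hAB : ∀ a ∈ A, a ∉ B) :
    ∃ c : ℝ, 0 < c ∧ ∏ b ∈ B, ∏ a ∈ A, (b - a) = c * (-1) ^
      (((B ×ˢ A).filter fun p => (conj p.1 = p.1 ∧ conj p.2 = p.2) ∧ p.1.re < p.2.re).card) := by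
  have hne : ∀ p ∈ B ×ˢ A, p.1 - p.2 ≠ 0 := fun p hp h => by
    rw [Finset.mem_product, sub_eq_zero.1 h] at hp
    exact hAB _ hp.2 hp.1
  obtain ⟨c, hc, h⟩ := prod_eq_pos_mul_prod_fixed (fun p : ℂ × ℂ => (conj p.1, conj p.2))
    (by simp) (fun p => p.1 - p.2) (by simp) (B ×ˢ A)
    (fun p hp => by
      rw [Finset.mem_product] at hp ⊢
      exact ⟨hB _ hp.1, hA _ hp.2⟩) hne
  rw [Finset.prod_product] at h
  rw [h]
  set T := (B ×ˢ A).filter fun p : ℂ × ℂ => (conj p.1, conj p.2) = p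
  refine ⟨c * ∏ p ∈ T, |p.1.re - p.2.re|, mul_pos hc (Finset.prod_pos fun p hp => ?_), ?_⟩
  · rw [Finset.mem_filter, Prod.ext_iff] at hp
    refine abs_pos.2 fun h => hne p hp.1 ?_
    rw [← Complex.conj_eq_iff_re.1 hp.2.1, ← Complex.conj_eq_iff_re.1 hp.2.2]
    exact_mod_cast h
  · have h1 : ((B ×ˢ A).filter fun p => (conj p.1 = p.1 ∧ conj p.2 = p.2) ∧ p.1.re < p.2.re) =
        T.filter fun p => p.1.re < p.2.re := by
      rw [Finset.filter_filter]
      simp only [Prod.ext_iff]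
    rw [h1, Finset.card_eq_sum_ones, Finset.sum_filter, ← Finset.prod_pow_eq_pow_sum]
    push_cast
    rw [mul_assoc, ← Finset.prod_mul_distrib]
    congr 1
    refine Finset.prod_congr (by ext; simp [T]) fun p hp => ?_
    rw [Finset.mem_filter, Prod.ext_iff] at hp
    have e1 := Complex.conj_eq_iff_re.1 hp.2.1
    have e2 := Complex.conj_eq_iff_re.1 hp.2.2
    have : p.1 - p.2 = ((p.1.re - p.2.re : ℝ) : ℂ) := by push_cast; rw [e1, e2]
    rw [this]
    split_ifs with hlt
    · rw [abs_of_neg (by linarith)]; push_cast; ring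
    · rw [abs_of_nonneg (by linarith)]; push_cast; ring

/-- The number of pairs `x₁ < x₂` with `x₁` a real root of `F` and `x₂` a real root of `G`. -/
noncomputable def rootPairs (F G : ℝ[X]) : Finset (ℝ × ℝ) :=
  (F.roots.toFinset ×ˢ G.roots.toFinset).filter fun p => p.1 < p.2

theorem card_rootPairs {F G : ℝ[X]} (hF : F ≠ 0) (hG : G ≠ 0) :
    (rootPairs F G).card = (((F.map (algebraMap ℝ ℂ)).roots.toFinset ×ˢ
      (G.map (algebraMap ℝ ℂ)).roots.toFinset).filter
        fun p => (conj p.1 = p.1 ∧ conj p.2 = p.2) ∧ p.1.re < p.2.re).card := by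
  have hF' : F.map (algebraMap ℝ ℂ) ≠ 0 := Polynomial.map_ne_zero hF
  have hG' : G.map (algebraMap ℝ ℂ) ≠ 0 := Polynomial.map_ne_zero hG
  have key : ∀ (F : ℝ[X]) (x : ℝ), eval (x : ℂ) (F.map (algebraMap ℝ ℂ)) = 0 ↔ eval x F = 0 := by
    intro F x
    have : eval (x : ℂ) (F.map (algebraMap ℝ ℂ)) = ((eval x F : ℝ) : ℂ) :=
      Polynomial.eval_map_algebraMap F (x : ℂ) |>.trans (by
        simpa using Polynomial.aeval_algebraMap_apply ℂ x F)
    rw [this]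
    exact_mod_cast Iff.rfl
  refine Finset.card_bij (fun p _ => ((p.1 : ℂ), (p.2 : ℂ))) ?_ ?_ ?_
  · intro p hp
    simp only [rootPairs, Finset.mem_filter, Finset.mem_product, Multiset.mem_toFinset,
      mem_roots hF, mem_roots hG, mem_roots hF', mem_roots hG', IsRoot.def, key] at hp ⊢
    simpa using hp
  · intro p _ q _ h
    simp only [Prod.mk.injEq, Complex.ofReal_inj] at h
    exact Prod.ext h.1 h.2
  · rintro ⟨b, a⟩ hp
    simp only [rootPairs, Finset.mem_filter, Finset.mem_product, Multiset.mem_toFinset,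
      mem_roots hF, mem_roots hG, mem_roots hF', mem_roots hG', IsRoot.def] at hp ⊢
    have e1 := Complex.conj_eq_iff_re.1 hp.2.1.1
    have e2 := Complex.conj_eq_iff_re.1 hp.2.1.2
    refine ⟨(b.re, a.re), ⟨⟨?_, ?_⟩, hp.2.2⟩, by rw [e1, e2]⟩
    · rw [← key, e1]; exact hp.1.1
    · rw [← key, e2]; exact hp.1.2

theorem conj_mem_roots_map {F : ℝ[X]} (hF : F ≠ 0) {a : ℂ}
    (ha : a ∈ (F.map (algebraMap ℝ ℂ)).roots) : conj a ∈ (F.map (algebraMap ℝ ℂ)).roots := by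
  rw [mem_roots (Polynomial.map_ne_zero hF), IsRoot.def, eval_map_algebraMap] at ha ⊢
  rw [aeval_conj, ha, map_zero]

variable {N : ℕ} {l : Fin N → ℕ} {L : ℕ} {e : (Σ m, Fin (l m)) ≃ Fin L}

theorem det_blockMatrix_sign
    (he : ∀ s t, e s < e t ↔ s.1 < t.1 ∨ (s.1 = t.1 ∧ (s.2 : ℕ) < t.2)) (Q : Fin N → ℝ[X])
    (hQ : ∀ m, (Q m).Monic) (hdeg : ∀ m, (Q m).natDegree = l m)
    (hs : ∀ m, ((Q m).map (algebraMap ℝ ℂ)).roots.Nodup)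
    (hd : ∀ m m', m ≠ m' → ∀ a ∈ ((Q m).map (algebraMap ℝ ℂ)).roots,
      a ∉ ((Q m').map (algebraMap ℝ ℂ)).roots) :
    0 < (blockMatrix e Q).det *
      ∏ m, ∏ m' > m, ((-1) ^ (l m * l m') * (-1) ^ (rootPairs (Q m') (Q m)).card) := by
  set B : Fin N → Finset ℂ := fun m => ((Q m).map (algebraMap ℝ ℂ)).roots.toFinset with hB
  have hcard : ∀ m, (B m).card = l m := fun m => by
    rw [Multiset.toFinset_card_of_nodup (hs m), splits_iff_card_roots.1 (IsAlgClosed.splits _),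
      natDegree_map, hdeg]
  set E : ∀ m, B m ≃ Fin (l m) := fun m => Finset.equivFinOfCardEq (hcard m)
  set r : (Σ m, Fin (l m)) → ℂ := fun s => ((E s.1).symm s.2 : ℂ) with hr
  have hprod : ∀ m (g : ℂ → ℂ), ∏ j, g (r ⟨m, j⟩) = ∏ a ∈ B m, g a := fun m g => by
    rw [← Finset.prod_coe_sort (B m)]
    exact Equiv.prod_comp (E m).symm fun x : B m => g x
  have hprodX : ∀ m, ∏ j, (X - C (r ⟨m, j⟩)) = (Q m).map (algebraMap ℝ ℂ) := fun m => by
    have h1 : ∏ j, (X - C (r ⟨m, j⟩)) = ∏ a ∈ B m, (X - C a) := by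
      rw [← Finset.prod_coe_sort (B m)]
      exact Equiv.prod_comp (E m).symm fun x : B m => (X - C (x : ℂ))
    rw [h1, (IsAlgClosed.splits ((Q m).map (algebraMap ℝ ℂ))).eq_prod_roots_of_monic
      ((hQ m).map _), Finset.prod, Multiset.toFinset_val, (hs m).dedup]
  have hinj : Function.Injective r := by
    rintro ⟨m, j⟩ ⟨m', j'⟩ h
    have h1 : r ⟨m, j⟩ ∈ B m := ((E m).symm j).2
    have h2 : r ⟨m', j'⟩ ∈ B m' := ((E m').symm j').2
    by_cases hm : m = m'
    · subst hm
      obtain rfl : j = j' := (E m).symm.injective (Subtype.ext h)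
      rfl
    · rw [← h] at h2
      exact absurd (Multiset.mem_toFinset.1 h2) (hd m m' hm _ (Multiset.mem_toFinset.1 h1))
  have hmain := det_blockMatrix (e := e) r hinj he
  simp only [hprodX] at hmain
  have hmap : (blockMatrix e fun m => (Q m).map (algebraMap ℝ ℂ)).det =
      (((blockMatrix e Q).det : ℝ) : ℂ) := by
    rw [← Complex.ofRealHom_eq_coe, RingHom.map_det]
    congr 1
    ext p s
    simp only [blockMatrix, RingHom.mapMatrix_apply, Matrix.map_apply, Matrix.of_apply]
    rw [← Polynomial.map_prod, Complex.ofRealHom_eq_coe]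
    have : (C ((s.1 : ℂ) + 1) * X ^ (s.2 : ℕ) : ℂ[X]) =
        (C ((s.1 : ℝ) + 1) * X ^ (s.2 : ℕ) : ℝ[X]).map (algebraMap ℝ ℂ) := by
      simp
    rw [this, ← Polynomial.map_mul, coeff_map]
    rfl
  have hpair : ∀ m m', ∃ c : ℝ, 0 < c ∧ (m < m' → ∏ j' : Fin (l m'), ∏ j : Fin (l m),
      (r ⟨m, j⟩ - r ⟨m', j'⟩) = c * ((-1) ^ (l m * l m') *
        (-1) ^ (rootPairs (Q m') (Q m)).card)) := by
    intro m m'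
    by_cases hlt : m < m'
    swap
    · exact ⟨1, one_pos, fun h => absurd h hlt⟩
    obtain ⟨c, hc, h⟩ := prod_prod_sub_eq (B m) (B m')
      (fun a ha => Multiset.mem_toFinset.2
        (conj_mem_roots_map (hQ m).ne_zero (Multiset.mem_toFinset.1 ha)))
      (fun a ha => Multiset.mem_toFinset.2
        (conj_mem_roots_map (hQ m').ne_zero (Multiset.mem_toFinset.1 ha)))
      (fun a ha ha' => hd m m' hlt.ne a (Multiset.mem_toFinset.1 ha) (Multiset.mem_toFinset.1 ha'))
    refine ⟨c, hc, fun _ => ?_⟩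
    rw [card_rootPairs (hQ m').ne_zero (hQ m).ne_zero, mul_left_comm, ← h]
    have h1 : ∀ j' : Fin (l m'), ∏ j : Fin (l m), (r ⟨m, j⟩ - r ⟨m', j'⟩) =
        (-1) ^ l m * ∏ a ∈ B m, (r ⟨m', j'⟩ - a) := fun j' => by
      rw [hprod m fun a => a - r ⟨m', j'⟩, ← hcard m, ← Finset.prod_const,
        ← Finset.prod_mul_distrib]
      exact Finset.prod_congr rfl fun a _ => by ring
    simp only [h1, Finset.prod_mul_distrib, Finset.prod_const, Finset.card_univ, Fintype.card_fin]
    rw [hprod m' fun b => ∏ a ∈ B m, (b - a), ← pow_mul]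
  choose c hc hceq using hpair
  have hfin : (blockMatrix e Q).det = (∏ s : (Σ m, Fin (l m)), ((s.1 : ℝ) + 1)) *
      ((∏ m, ∏ m' > m, c m m') *
      ∏ m, ∏ m' > m, ((-1) ^ (l m * l m') * (-1) ^ (rootPairs (Q m') (Q m)).card)) := by
    have : (((blockMatrix e Q).det : ℝ) : ℂ) = _ := hmap.symm.trans hmain
    rw [← Complex.ofReal_inj, this]
    push_cast
    congr 1
    simp only [← Finset.prod_mul_distrib]
    refine Finset.prod_congr rfl fun m _ => Finset.prod_congr rfl fun m' hm => ?_
    exact hceq m m' (Finset.mem_Ioi.1 hm)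
  have hsq : (∏ m : Fin N, ∏ m' > m, ((-1 : ℝ) ^ (l m * l m') *
      (-1) ^ (rootPairs (Q m') (Q m)).card)) ≠ 0 := by
    simp [Finset.prod_ne_zero_iff]
  rw [hfin, ← mul_assoc, mul_assoc (_ * _)]
  refine mul_pos (mul_pos (Finset.prod_pos fun s _ => by positivity)
    (Finset.prod_pos fun m _ => Finset.prod_pos fun m' _ => hc m m')) (mul_self_pos.2 hsq)

end RealSign

theorem exists_lex_equiv {N : ℕ} (l : Fin N → ℕ) {L : ℕ} (hL : ∑ m, l m = L) :
    ∃ e : (Σ m, Fin (l m)) ≃ Fin L,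
      ∀ s t, e s < e t ↔ s.1 < t.1 ∨ (s.1 = t.1 ∧ (s.2 : ℕ) < t.2) := by
  have hc : Fintype.card (Σₗ m, Fin (l m)) = L := by
    rw [← hL]
    exact (Fintype.card_sigma).trans (by simp)
  let f := (Fintype.orderIsoFinOfCardEq (Σₗ m, Fin (l m)) hc).symm
  refine ⟨toLex.trans f.toEquiv, fun s t => ?_⟩
  have : f (toLex s) < f (toLex t) ↔ _ := f.lt_iff_lt.trans Sigma.Lex.lt_def
  refine this.trans (or_congr Iff.rfl ?_)
  obtain ⟨m, j⟩ := s
  obtain ⟨m', j'⟩ := t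
  constructor
  · rintro ⟨h, h2⟩
    have h : m = m' := h
    subst h
    exact ⟨rfl, h2⟩
  · rintro ⟨h, h2⟩
    have h : m = m' := h
    subst h
    exact ⟨rfl, h2⟩

section Passport

variable {k n : ℕ} {l : Fin k → Fin n → ℕ}

/-- The monic polynomial whose roots are the points of multiplicity `m + 1` over the branch
point `i`, in terms of its non-leading coefficients. -/
noncomputable def factorPoly (x : (Σ i : Fin k, Σ m : Fin n, Fin (l i m)) ⊕ Unit → ℝ)
    (i : Fin k) (m : Fin n) : ℝ[X] :=
  X ^ l i m + ∑ j : Fin (l i m), C (x (Sum.inl ⟨i, m, j⟩)) * X ^ (j : ℕ)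

noncomputable def fullPoly (x : (Σ i : Fin k, Σ m : Fin n, Fin (l i m)) ⊕ Unit → ℝ)
    (i : Fin k) : ℝ[X] :=
  ∏ m, factorPoly x i m ^ ((m : ℕ) + 1)

noncomputable def ramPoly (x : (Σ i : Fin k, Σ m : Fin n, Fin (l i m)) ⊕ Unit → ℝ)
    (i : Fin k) : ℝ[X] :=
  ∏ m, factorPoly x i m ^ (m : ℕ)

/-- The cofactor of `ramPoly` in a derivation applied to `fullPoly`, where `D m` is the
derivation applied to the factors. -/
noncomputable def logDer {N : ℕ} (Q D : Fin N → ℝ[X]) : ℝ[X] :=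
  ∑ m : Fin N, C ((m : ℝ) + 1) * D m * ∏ m' ∈ {m}ᶜ, Q m'

noncomputable def critDefect (x : (Σ i : Fin k, Σ m : Fin n, Fin (l i m)) ⊕ Unit → ℝ)
    (i : Fin k) : ℝ[X] :=
  logDer (factorPoly x i) (fun m => derivative (factorPoly x i m)) -
    C (n : ℝ) * ∏ j ∈ {i}ᶜ, ramPoly x j

variable (x : (Σ i : Fin k, Σ m : Fin n, Fin (l i m)) ⊕ Unit → ℝ)

theorem degree_factorPoly_tail_lt (i : Fin k) (m : Fin n) :
    (∑ j : Fin (l i m), C (x (Sum.inl ⟨i, m, j⟩)) * X ^ (j : ℕ)).degree <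
      ((l i m : ℕ) : WithBot ℕ) := by
  refine (degree_sum_le _ _).trans_lt ((Finset.sup_lt_iff (WithBot.bot_lt_coe _)).2 fun p _ => ?_)
  exact (degree_C_mul_X_pow_le _ _).trans_lt (by exact_mod_cast p.2)

theorem monic_factorPoly (i : Fin k) (m : Fin n) : (factorPoly x i m).Monic :=
  monic_X_pow_add (degree_factorPoly_tail_lt x i m)

theorem natDegree_factorPoly (i : Fin k) (m : Fin n) : (factorPoly x i m).natDegree = l i m := by
  have := degree_add_eq_left_of_degree_lt (p := (X : ℝ[X]) ^ l i m)
    (q := ∑ j : Fin (l i m), C (x (Sum.inl ⟨i, m, j⟩)) * X ^ (j : ℕ))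
    (by simpa using degree_factorPoly_tail_lt x i m)
  rw [degree_X_pow] at this
  exact natDegree_eq_of_degree_eq_some this

theorem coeff_factorPoly (i : Fin k) (m : Fin n) (j : Fin (l i m)) :
    (factorPoly x i m).coeff j = x (Sum.inl ⟨i, m, j⟩) := by
  rw [factorPoly, coeff_add, coeff_X_pow, if_neg j.2.ne, zero_add, finsetSum_coeff,
    Finset.sum_eq_single j]
  · simp
  · intro b _ hb
    rw [coeff_C_mul_X_pow, if_neg]
    exact fun h => hb (Fin.ext h.symm)
  · simp

theorem monic_fullPoly (i : Fin k) : (fullPoly x i).Monic :=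
  monic_prod_of_monic _ _ fun m _ => (monic_factorPoly x i m).pow _

theorem monic_ramPoly (i : Fin k) : (ramPoly x i).Monic :=
  monic_prod_of_monic _ _ fun m _ => (monic_factorPoly x i m).pow _

theorem natDegree_fullPoly (i : Fin k) :
    (fullPoly x i).natDegree = ∑ m, l i m * ((m : ℕ) + 1) := by
  rw [fullPoly, natDegree_prod_of_monic _ _ fun m _ => (monic_factorPoly x i m).pow _]
  exact Finset.sum_congr rfl fun m _ => by
    rw [(monic_factorPoly x i m).natDegree_pow, natDegree_factorPoly, mul_comm]

theorem natDegree_ramPoly (i : Fin k) : (ramPoly x i).natDegree = ∑ m, l i m * (m : ℕ) := by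
  rw [ramPoly, natDegree_prod_of_monic _ _ fun m _ => (monic_factorPoly x i m).pow _]
  exact Finset.sum_congr rfl fun m _ => by
    rw [(monic_factorPoly x i m).natDegree_pow, natDegree_factorPoly, mul_comm]

theorem fullPoly_eq (i : Fin k) : fullPoly x i = ramPoly x i * ∏ m, factorPoly x i m := by
  rw [fullPoly, ramPoly, ← Finset.prod_mul_distrib]
  exact Finset.prod_congr rfl fun m _ => pow_succ _ _

theorem sum_prod_erase_eq_mul_logDer {N : ℕ} (Q D : Fin N → ℝ[X]) :
    ∑ m : Fin N, (∏ m' ∈ Finset.univ.erase m, Q m' ^ ((m' : ℕ) + 1)) *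
      (C ((m : ℝ) + 1) * Q m ^ (m : ℕ) * D m) = (∏ m, Q m ^ (m : ℕ)) * logDer Q D := by
  rw [logDer, Finset.mul_sum]
  refine Finset.sum_congr rfl fun m _ => ?_
  rw [← Finset.mul_prod_erase Finset.univ (fun m => Q m ^ (m : ℕ)) (Finset.mem_univ m),
    Finset.compl_singleton]
  simp only [pow_succ, Finset.prod_mul_distrib]
  ring

theorem derivative_fullPoly (i : Fin k) : derivative (fullPoly x i) =
    ramPoly x i * logDer (factorPoly x i) (fun m => derivative (factorPoly x i m)) := by
  rw [ramPoly, ← sum_prod_erase_eq_mul_logDer, fullPoly, derivative_prod_finset]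
  refine Finset.sum_congr rfl fun m _ => ?_
  rw [derivative_pow_succ]

theorem ramPoly_mul_critDefect (i : Fin k) : ramPoly x i * critDefect x i =
    derivative (fullPoly x i) - C (n : ℝ) * ∏ j, ramPoly x j := by
  rw [critDefect, mul_sub, ← derivative_fullPoly, Fintype.prod_eq_mul_prod_compl i]
  ring

variable (hn : ∀ i, ∑ m, l i m * ((m : ℕ) + 1) = n)
  (hd : ∑ i, ∑ m, l i m * (m : ℕ) = n - 1)

include hd in
theorem natDegree_prod_ramPoly : (∏ j, ramPoly x j).natDegree = n - 1 := by
  rw [natDegree_prod_of_monic _ _ fun j _ => monic_ramPoly x j, ← hd]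
  exact Finset.sum_congr rfl fun j _ => natDegree_ramPoly x j

theorem monic_prod_ramPoly : (∏ j, ramPoly x j).Monic :=
  monic_prod_of_monic _ _ fun j _ => monic_ramPoly x j

include hn hd in
theorem degree_critDefect_lt (hn1 : 0 < n) {i : Fin k} {L : ℕ} (hL : ∑ m, l i m = L) :
    (critDefect x i).degree < ((L - 1 : ℕ) : WithBot ℕ) := by
  have h1 : (ramPoly x i * critDefect x i).degree < ((n - 1 : ℕ) : WithBot ℕ) := by
    rw [ramPoly_mul_critDefect, degree_lt_iff_coeff_zero]
    intro j hj
    have hdeg := natDegree_prod_ramPoly x hd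
    have hdeg2 : (fullPoly x i).natDegree = n := (natDegree_fullPoly x i).trans (hn i)
    rw [coeff_sub, coeff_derivative, coeff_C_mul]
    obtain rfl | hlt := eq_or_lt_of_le hj
    · have e1 : (fullPoly x i).coeff (n - 1 + 1) = 1 := by
        have := monic_fullPoly x i
        rw [Monic, leadingCoeff, hdeg2] at this
        exact (congrArg _ (Nat.sub_add_cancel hn1)).trans this
      have e2 : (∏ j, ramPoly x j).coeff (n - 1) = 1 := by
        rw [← hdeg]; exact monic_prod_ramPoly x
      rw [e1, e2, ← Nat.cast_add_one, Nat.sub_add_cancel hn1]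
      ring
    · rw [coeff_eq_zero_of_natDegree_lt (p := fullPoly x i) (by omega),
        coeff_eq_zero_of_natDegree_lt (p := ∏ j, ramPoly x j) (by omega)]
      ring
  by_cases h0 : critDefect x i = 0
  · rw [h0, degree_zero]; exact WithBot.bot_lt_coe _
  rw [degree_mul, degree_eq_natDegree h0,
    degree_eq_natDegree (monic_ramPoly x i).ne_zero, natDegree_ramPoly] at h1
  rw [degree_eq_natDegree h0]
  have h2 := hn i
  simp only [mul_add, mul_one, Finset.sum_add_distrib, hL] at h2
  norm_cast at h1 ⊢
  omega

end Passport

section Scaling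

variable {c : ℝ} {d : ℕ} {F G : ℝ[X]}

/-- `F` is obtained from `G`, thought of as having degree `d`, by scaling the roots by `c`. -/
def IsScaled (c : ℝ) (d : ℕ) (F G : ℝ[X]) : Prop := F.comp (C c * X) = C (c ^ d) * G

theorem IsScaled.pow (h : IsScaled c d F G) (m : ℕ) : IsScaled c (d * m) (F ^ m) (G ^ m) := by
  rw [IsScaled, pow_comp, h, mul_pow, ← C_pow, pow_mul]

theorem IsScaled.prod {ι : Type*} (s : Finset ι) {d : ι → ℕ} {F G : ι → ℝ[X]}
    (h : ∀ i, IsScaled c (d i) (F i) (G i)) :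
    IsScaled c (∑ i ∈ s, d i) (∏ i ∈ s, F i) (∏ i ∈ s, G i) := by
  rw [IsScaled, prod_comp, Finset.prod_congr rfl fun i _ => h i, Finset.prod_mul_distrib,
    ← map_prod, Finset.prod_pow_eq_pow_sum]

theorem IsScaled.derivative (hc : c ≠ 0) (h : IsScaled c (d + 1) F G) :
    IsScaled c d (derivative F) (derivative G) := by
  have h1 := congrArg Polynomial.derivative h
  rw [derivative_comp, derivative_C_mul, derivative_C_mul, derivative_X, mul_one, pow_succ', C_mul,
    mul_assoc] at h1
  exact mul_left_cancel₀ (C_ne_zero.2 hc) h1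

theorem IsScaled.coeff (h : IsScaled c d F G) (j : ℕ) :
    c ^ j * F.coeff j = c ^ d * G.coeff j := by
  have := congrArg (fun P => Polynomial.coeff P j) h
  simp only [comp_C_mul_X_coeff, coeff_C_mul] at this
  rw [← this, mul_comm]

end Scaling

/-- A real polynomial of degree `n` all of whose complex critical points are roots is the
`n`-th power of a linear polynomial. -/
theorem eq_X_pow_of_roots_derivative {n : ℕ} (hn : 0 < n) {P : ℝ[X]} (hP : P.Monic)
    (hdeg : P.natDegree = n) (hcoeff : P.coeff (n - 1) = 0)
    (h : ∀ a : ℂ, aeval a (derivative P) = 0 → aeval a P = 0) : P = X ^ n := by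
  set p : ℂ[X] := P.map (algebraMap ℝ ℂ) with hp
  have hpm : p.Monic := hP.map _
  have hpd : p.natDegree = n := (natDegree_map _).trans hdeg
  have hp' : (derivative p).natDegree = n - 1 := by rw [natDegree_derivative, hpd]
  have hp0 : p ≠ 0 := hpm.ne_zero
  have hc1 : p.roots.card = n := by
    rw [splits_iff_card_roots.1 (IsAlgClosed.splits p), hpd]
  have hc2 : (derivative p).roots.card = n - 1 := by
    rw [splits_iff_card_roots.1 (IsAlgClosed.splits _), hp']
  have hsub : (derivative p).roots ⊆ p.roots := by
    intro a ha
    rw [mem_roots', IsRoot.def, hp, derivative_map, eval_map_algebraMap] at ha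
    rw [mem_roots hp0, IsRoot.def, hp, eval_map_algebraMap]
    exact h a ha.2
  have hle : (derivative p).roots + p.roots.toFinset.val ≤ p.roots := by
    rw [Multiset.le_iff_count]
    intro a
    by_cases ha : a ∈ p.roots
    · rw [Multiset.count_add, count_roots, count_roots,
        derivative_rootMultiplicity_of_root ((mem_roots hp0).1 ha), Multiset.toFinset_val,
        Multiset.count_dedup, if_pos ha]
      have := (rootMultiplicity_pos hp0).2 ((mem_roots hp0).1 ha)
      omega
    · rw [Multiset.count_eq_zero_of_notMem]
      · exact Nat.zero_le _
      · rw [Multiset.mem_add, Multiset.toFinset_val, Multiset.mem_dedup]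
        exact fun h => h.elim (fun h => ha (hsub h)) ha
  have hcard := Multiset.card_le_card hle
  rw [Multiset.card_add, hc1, hc2, ← Finset.card_def] at hcard
  obtain ⟨a, ha⟩ : ∃ a, p.roots = Multiset.replicate n a := by
    obtain ⟨a, ha⟩ := Multiset.card_pos_iff_exists_mem.1 (hc1 ▸ hn)
    refine ⟨a, Multiset.eq_replicate.2 ⟨hc1, fun b hb => ?_⟩⟩
    exact Finset.card_le_one.1 (by omega : p.roots.toFinset.card ≤ 1) b
      (Multiset.mem_toFinset.2 hb) a (Multiset.mem_toFinset.2 ha)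
  have hsum := (IsAlgClosed.splits p).nextCoeff_eq_neg_sum_roots_of_monic hpm
  have hnext : p.nextCoeff = 0 := by
    rw [nextCoeff_of_natDegree_pos (by omega), hpd, hp, coeff_map, hcoeff, map_zero]
  rw [hnext, ha, Multiset.sum_replicate, zero_eq_neg, nsmul_eq_mul, mul_eq_zero] at hsum
  have ha0 : a = 0 := hsum.resolve_left (by exact_mod_cast hn.ne')
  have hfin := (IsAlgClosed.splits p).eq_prod_roots_of_monic hpm
  rw [ha, ha0] at hfin
  refine Polynomial.map_injective (algebraMap ℝ ℂ) (algebraMap ℝ ℂ).injective ?_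
  rw [← hp, hfin]
  simp

section Hurwitz

variable {k n : ℕ} {l : Fin k → Fin n → ℕ} {L : Fin k → ℕ}
  (e : ∀ i, (Σ m, Fin (l i m)) ≃ Fin (L i)) (i₀ : Fin k)
  (hn : ∀ i, ∑ m, l i m * ((m : ℕ) + 1) = n)
  (hd : ∑ i, ∑ m, l i m * (m : ℕ) = n - 1) (hn1 : 0 < n) (hL : ∀ i, ∑ m, l i m = L i)

/-- The polynomial map whose fibres over the points `hurwitzTarget w` are the sets of normalized
polynomials with prescribed ramification over `w`. -/
noncomputable def hurwitzMap (x : (Σ i : Fin k, Σ m : Fin n, Fin (l i m)) ⊕ Unit → ℝ) :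
    (Σ i : Fin k, Σ m : Fin n, Fin (l i m)) ⊕ Unit → ℝ :=
  blockVec e (fun i => X * critDefect x i + C ((fullPoly x i).coeff 0 - x (Sum.inr ())))
    ((fullPoly x i₀).coeff (n - 1))

noncomputable def hurwitzTarget (w : Fin k → ℝ) :
    (Σ i : Fin k, Σ m : Fin n, Fin (l i m)) ⊕ Unit → ℝ :=
  blockVec e (fun i => C (-w i)) 0

include hL hn hn1 in
theorem one_le_blockSize (i : Fin k) : 1 ≤ L i := by
  by_contra h
  have h1 : ∑ m, l i m = 0 := by have := hL i; omega
  have h2 := hn i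
  rw [Finset.sum_eq_zero fun m hm => by
    rw [Finset.sum_eq_zero_iff.1 h1 m hm, zero_mul]] at h2
  omega

include hn hd hn1 hL in
theorem hurwitzMap_eq_target_iff (x : (Σ i : Fin k, Σ m : Fin n, Fin (l i m)) ⊕ Unit → ℝ)
    (w : Fin k → ℝ) : hurwitzMap e i₀ x = hurwitzTarget e w ↔
      (∀ i, critDefect x i = 0 ∧ (fullPoly x i).coeff 0 = x (Sum.inr ()) - w i) ∧
        (fullPoly x i₀).coeff (n - 1) = 0 := by
  have hL1 := one_le_blockSize hn hn1 hL
  constructor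
  · intro h
    have h0 := congrFun h (Sum.inr ())
    simp only [hurwitzMap, hurwitzTarget, blockVec, Sum.elim_inr] at h0
    refine ⟨fun i => ?_, h0⟩
    have h1 : blockPoly e i (hurwitzMap e i₀ x) = blockPoly e i (hurwitzTarget e w) := by rw [h]
    rw [hurwitzMap, hurwitzTarget, blockPoly_blockVec, blockPoly_blockVec] at h1
    · have h2 : ∀ j, (critDefect x i).coeff j = 0 := fun j => by
        simpa using congrArg (fun P => coeff P (j + 1)) h1
      have h3 := congrArg (fun P => coeff P 0) h1
      simp only [coeff_add, mul_coeff_zero, coeff_X_zero, zero_mul, coeff_C_zero, zero_add] at h3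
      exact ⟨Polynomial.ext fun j => by simpa using h2 j, by linarith⟩
    · exact degree_C_le.trans_lt (by exact_mod_cast hL1 i)
    · exact degree_X_mul_add_C_lt (hL1 i) (degree_critDefect_lt x hn hd hn1 (hL i)) _
  · rintro ⟨h1, h2⟩
    rw [hurwitzMap, hurwitzTarget, h2]
    congr 1
    funext i
    rw [(h1 i).1, (h1 i).2]
    simp

theorem derivative_eq_of_critDefect_eq_zero
    {x : (Σ i : Fin k, Σ m : Fin n, Fin (l i m)) ⊕ Unit → ℝ} {i : Fin k}
    (h : critDefect x i = 0) : derivative (fullPoly x i) = C (n : ℝ) * ∏ j, ramPoly x j := by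
  have := ramPoly_mul_critDefect x i
  rw [h, mul_zero] at this
  exact (sub_eq_zero.1 this.symm)

theorem aeval_fullPoly_eq_zero_of_ramPoly
    (x : (Σ i : Fin k, Σ m : Fin n, Fin (l i m)) ⊕ Unit → ℝ) {i : Fin k} {a : ℂ}
    (h : aeval a (ramPoly x i) = 0) : aeval a (fullPoly x i) = 0 := by
  rw [fullPoly_eq, map_mul, h, zero_mul]

theorem fullPoly_sub_fullPoly {x : (Σ i : Fin k, Σ m : Fin n, Fin (l i m)) ⊕ Unit → ℝ}
    {w : Fin k → ℝ} (h : ∀ i, critDefect x i = 0 ∧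
      (fullPoly x i).coeff 0 = x (Sum.inr ()) - w i) (i j : Fin k) :
    fullPoly x i + C (w i) = fullPoly x j + C (w j) := by
  have h1 : derivative (fullPoly x i - fullPoly x j) = 0 := by
    rw [derivative_sub, derivative_eq_of_critDefect_eq_zero (h i).1,
      derivative_eq_of_critDefect_eq_zero (h j).1, sub_self]
  have h2 := eq_C_of_derivative_eq_zero h1
  rw [coeff_sub, (h i).2, (h j).2, sub_eq_iff_eq_add] at h2
  rw [h2]
  simp only [C_sub]
  ring

include hn hd hn1 hL in
theorem eq_zero_of_hurwitzMap_eq_zero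
    {x : (Σ i : Fin k, Σ m : Fin n, Fin (l i m)) ⊕ Unit → ℝ} (h : hurwitzMap e i₀ x = 0) :
    x = 0 := by
  have h0 : hurwitzTarget e (0 : Fin k → ℝ) = 0 := by
    funext q; rcases q with q | q <;> simp [hurwitzTarget, blockVec]
  rw [← h0, hurwitzMap_eq_target_iff e i₀ hn hd hn1 hL] at h
  have hsame : ∀ i, fullPoly x i = fullPoly x i₀ := fun i => by
    simpa using fullPoly_sub_fullPoly h.1 i i₀
  have hX : ∀ i, fullPoly x i = X ^ n := fun i => by
    rw [hsame]
    refine eq_X_pow_of_roots_derivative hn1 (monic_fullPoly x i₀)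
      ((natDegree_fullPoly x i₀).trans (hn i₀)) h.2 fun a ha => ?_
    rw [derivative_eq_of_critDefect_eq_zero (h.1 i₀).1, map_mul, map_prod, aeval_C, mul_eq_zero,
      Finset.prod_eq_zero_iff] at ha
    rcases ha with ha | ⟨j, -, hj⟩
    · exact absurd ha (by simp; omega)
    · rw [← hsame j]
      exact aeval_fullPoly_eq_zero_of_ramPoly x hj
  have hfac : ∀ i m, factorPoly x i m = X ^ l i m := fun i m => by
    have h1 : factorPoly x i m ∣ X ^ n := by
      rw [← hX i, fullPoly]
      exact (dvd_pow_self _ (Nat.succ_ne_zero _)).trans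
        (Finset.dvd_prod_of_mem (fun m : Fin n => factorPoly x i m ^ ((m : ℕ) + 1))
          (Finset.mem_univ m))
    obtain ⟨j, -, hj⟩ := (dvd_prime_pow prime_X n).1 h1
    have h2 := eq_of_monic_of_associated (monic_factorPoly x i m) (monic_X_pow j) hj
    have h3 := natDegree_factorPoly x i m
    rw [h2, natDegree_X_pow] at h3
    rw [h2, h3]
  funext q
  rcases q with ⟨i, m, j⟩ | ⟨⟩
  · rw [← coeff_factorPoly x i m j, hfac, coeff_X_pow, if_neg j.2.ne]; rfl
  · have := (h.1 i₀).2
    rw [hX, coeff_X_pow, if_neg hn1.ne] at this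
    simpa using this.symm

end Hurwitz

section CoeffSmooth

open scoped ContDiff

variable {E : Type*} [NormedAddCommGroup E] [NormedSpace ℝ E] {f g : E → ℝ[X]}

/-- All coefficients are smooth functions. -/
def CoeffSmooth (f : E → ℝ[X]) : Prop := ∀ j, ContDiff ℝ ∞ fun x => (f x).coeff j

theorem CoeffSmooth.const (p : ℝ[X]) : CoeffSmooth fun _ : E => p := fun _ => contDiff_const

theorem CoeffSmooth.add (hf : CoeffSmooth f) (hg : CoeffSmooth g) :
    CoeffSmooth fun x => f x + g x := fun j => by
  simp only [coeff_add]
  exact (hf j).add (hg j)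

theorem CoeffSmooth.sub (hf : CoeffSmooth f) (hg : CoeffSmooth g) :
    CoeffSmooth fun x => f x - g x := fun j => by
  simp only [coeff_sub]
  exact (hf j).sub (hg j)

theorem CoeffSmooth.mul (hf : CoeffSmooth f) (hg : CoeffSmooth g) :
    CoeffSmooth fun x => f x * g x := fun j => by
  simp only [coeff_mul]
  exact ContDiff.sum fun p _ => (hf p.1).mul (hg p.2)

theorem CoeffSmooth.derivative (hf : CoeffSmooth f) :
    CoeffSmooth fun x => derivative (f x) := fun j => by
  simp only [coeff_derivative]
  exact (hf (j + 1)).mul contDiff_const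

theorem CoeffSmooth.C {g : E → ℝ} (hg : ContDiff ℝ ∞ g) : CoeffSmooth fun x => C (g x) :=
  fun j => by
    simp only [coeff_C]
    split_ifs
    · exact hg
    · exact contDiff_const

theorem CoeffSmooth.pow (hf : CoeffSmooth f) (m : ℕ) : CoeffSmooth fun x => f x ^ m := by
  induction m with
  | zero => simpa using CoeffSmooth.const 1
  | succ m ih => simpa only [pow_succ] using ih.mul hf

theorem CoeffSmooth.sum {ι : Type*} (s : Finset ι) {f : ι → E → ℝ[X]}
    (hf : ∀ i, CoeffSmooth (f i)) : CoeffSmooth fun x => ∑ i ∈ s, f i x := fun j => by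
  simp only [finsetSum_coeff]
  exact ContDiff.sum fun i _ => hf i j

theorem CoeffSmooth.prod {ι : Type*} (s : Finset ι) {f : ι → E → ℝ[X]}
    (hf : ∀ i, CoeffSmooth (f i)) : CoeffSmooth fun x => ∏ i ∈ s, f i x := by
  induction s using Finset.induction_on with
  | empty => simpa using CoeffSmooth.const 1
  | insert a s ha ih => simpa only [Finset.prod_insert ha] using (hf a).mul ih

end CoeffSmooth

section Hurwitz

open scoped ContDiff

variable {k n : ℕ} {l : Fin k → Fin n → ℕ} {L : Fin k → ℕ}
  (e : ∀ i, (Σ m, Fin (l i m)) ≃ Fin (L i)) (i₀ : Fin k)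
  (hn : ∀ i, ∑ m, l i m * ((m : ℕ) + 1) = n)
  (hd : ∑ i, ∑ m, l i m * (m : ℕ) = n - 1) (hn1 : 0 < n) (hL : ∀ i, ∑ m, l i m = L i)

theorem coeffSmooth_factorPoly (i : Fin k) (m : Fin n) :
    CoeffSmooth fun x : (Σ i : Fin k, Σ m : Fin n, Fin (l i m)) ⊕ Unit → ℝ =>
      factorPoly x i m :=
  (CoeffSmooth.const _).add (CoeffSmooth.sum _ fun _ =>
    (CoeffSmooth.C (contDiff_apply _ _ _)).mul (CoeffSmooth.const _))

theorem coeffSmooth_fullPoly (i : Fin k) :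
    CoeffSmooth fun x : (Σ i : Fin k, Σ m : Fin n, Fin (l i m)) ⊕ Unit → ℝ =>
      fullPoly x i :=
  CoeffSmooth.prod _ fun m => (coeffSmooth_factorPoly i m).pow _

theorem coeffSmooth_ramPoly (i : Fin k) :
    CoeffSmooth fun x : (Σ i : Fin k, Σ m : Fin n, Fin (l i m)) ⊕ Unit → ℝ =>
      ramPoly x i :=
  CoeffSmooth.prod _ fun m => (coeffSmooth_factorPoly i m).pow _

theorem coeffSmooth_critDefect (i : Fin k) :
    CoeffSmooth fun x : (Σ i : Fin k, Σ m : Fin n, Fin (l i m)) ⊕ Unit → ℝ =>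
      critDefect x i := by
  unfold critDefect logDer
  refine CoeffSmooth.sub (CoeffSmooth.sum _ fun m => ?_) ?_
  · exact ((CoeffSmooth.const _).mul (coeffSmooth_factorPoly i m).derivative).mul
      (CoeffSmooth.prod _ fun m' => coeffSmooth_factorPoly i m')
  · exact (CoeffSmooth.const _).mul (CoeffSmooth.prod _ fun j => coeffSmooth_ramPoly j)

theorem contDiff_hurwitzMap : ContDiff ℝ ∞ (hurwitzMap e i₀) := by
  rw [contDiff_pi]
  rintro (⟨i, p⟩ | ⟨⟩)
  · exact ((CoeffSmooth.const X).mul (coeffSmooth_critDefect i)).add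
      (CoeffSmooth.C ((coeffSmooth_fullPoly i 0).sub (contDiff_apply _ _ _))) (e i p)
  · exact coeffSmooth_fullPoly i₀ (n - 1)

theorem isScaled_factorPoly {c : ℝ} {x y : (Σ i : Fin k, Σ m : Fin n, Fin (l i m)) ⊕ Unit → ℝ}
    (h : ∀ i m (j : Fin (l i m)),
      x (Sum.inl ⟨i, m, j⟩) = c ^ (l i m - j) * y (Sum.inl ⟨i, m, j⟩)) (i : Fin k) (m : Fin n) :
    IsScaled c (l i m) (factorPoly x i m) (factorPoly y i m) := by
  simp only [IsScaled, factorPoly, add_comp, X_comp, Polynomial.sum_comp, mul_comp, C_comp, pow_comp, mul_add,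
    Finset.mul_sum, mul_pow, h, C_mul, C_pow]
  congr 1
  refine Finset.sum_congr rfl fun j _ => ?_
  have : (C c : ℝ[X]) ^ l i m = C c ^ (l i m - j) * C c ^ (j : ℕ) := by
    rw [← pow_add, Nat.sub_add_cancel j.2.le]
  rw [this]
  ring

include hn hd hn1 hL in
theorem isScaled_critDefect {c : ℝ} (hc : 0 < c)
    {x y : (Σ i : Fin k, Σ m : Fin n, Fin (l i m)) ⊕ Unit → ℝ}
    (h : ∀ i m (j : Fin (l i m)),
      x (Sum.inl ⟨i, m, j⟩) = c ^ (l i m - j) * y (Sum.inl ⟨i, m, j⟩)) (i : Fin k) :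
    IsScaled c n (fullPoly x i) (fullPoly y i) ∧
      IsScaled c (L i - 1) (critDefect x i) (critDefect y i) := by
  have hQ := isScaled_factorPoly h
  have hP : IsScaled c n (fullPoly x i) (fullPoly y i) := by
    have := IsScaled.prod Finset.univ fun m => (hQ i m).pow ((m : ℕ) + 1)
    rwa [hn i] at this
  have hR : ∀ j, IsScaled c (∑ m, l j m * (m : ℕ)) (ramPoly x j) (ramPoly y j) := fun j =>
    IsScaled.prod _ fun m => (hQ j m).pow _
  have hRR : IsScaled c (n - 1) (∏ j, ramPoly x j) (∏ j, ramPoly y j) := by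
    rw [← hd]
    exact IsScaled.prod _ hR
  have hP' : IsScaled c (n - 1) (derivative (fullPoly x i)) (derivative (fullPoly y i)) := by
    refine IsScaled.derivative hc.ne' ?_
    rwa [Nat.sub_add_cancel hn1]
  have hdeg : n - 1 = ∑ m, l i m * (m : ℕ) + (L i - 1) := by
    have h1 := hn i
    have h2 := one_le_blockSize hn hn1 hL i
    simp only [mul_add, mul_one, Finset.sum_add_distrib, hL] at h1
    omega
  refine ⟨hP, ?_⟩
  have h1 := congrArg (fun p => p.comp (C c * X)) (ramPoly_mul_critDefect x i)
  simp only [mul_comp, sub_comp, C_comp] at h1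
  rw [hR i, hP', hRR, mul_left_comm (C (n : ℝ)), ← mul_sub, ← ramPoly_mul_critDefect, hdeg,
    pow_add, C_mul] at h1
  have h2 : C (c ^ ∑ m, l i m * (m : ℕ)) * ramPoly y i ≠ 0 :=
    mul_ne_zero (C_ne_zero.2 (pow_pos hc _).ne') (monic_ramPoly y i).ne_zero
  refine mul_left_cancel₀ h2 ?_
  rw [h1]
  ring

include hn hd hn1 hL in
theorem boundedPreimages_hurwitzMap : BoundedPreimages (hurwitzMap e i₀) := by
  refine boundedPreimages_of_weightedHomogeneous (contDiff_hurwitzMap e i₀).continuous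
    (Sum.elim (fun q => l q.1 q.2.1 - q.2.2) fun _ => n)
    (Sum.elim (fun q => if (e q.1 q.2 : ℕ) = 0 then n else L q.1 - e q.1 q.2) fun _ => 1)
    ?_ ?_ ?_ fun x => eq_zero_of_hurwitzMap_eq_zero e i₀ hn hd hn1 hL
  · rintro (⟨i, m, j⟩ | ⟨⟩)
    · have := j.2
      simp only [Sum.elim_inl]
      omega
    · simp only [Sum.elim_inr]; omega
  · rintro (⟨i, p⟩ | ⟨⟩)
    · have := (e i p).2
      simp only [Sum.elim_inl]
      split_ifs <;> omega
    · simp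
  · intro c hc y q
    set x : (Σ i : Fin k, Σ m : Fin n, Fin (l i m)) ⊕ Unit → ℝ := fun q =>
      c ^ Sum.elim (fun q : (Σ i : Fin k, Σ m : Fin n, Fin (l i m)) => l q.1 q.2.1 - (q.2.2 : ℕ))
        (fun _ : Unit => n) q * y q with hx
    have hs := isScaled_critDefect hn hd hn1 hL hc (x := x) (y := y) fun i m j => rfl
    rcases q with ⟨i, p⟩ | ⟨⟩
    · simp only [hurwitzMap, blockVec, Sum.elim_inl]
      split_ifs with h0
      · have h1 := (hs i).1.coeff 0
        rw [pow_zero, one_mul] at h1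
        have h2 : x (Sum.inr ()) = c ^ n * y (Sum.inr ()) := rfl
        simp only [h0, coeff_add, mul_coeff_zero, coeff_X_zero, zero_mul, coeff_C_zero, h1, h2]
        ring
      · obtain ⟨j, hj⟩ := Nat.exists_eq_succ_of_ne_zero h0
        have h1 := (hs i).2.coeff j
        rw [hj, Nat.succ_eq_add_one, coeff_add, coeff_X_mul, coeff_C_succ, coeff_add, coeff_X_mul,
          coeff_C_succ, add_zero, add_zero]
        have h3 := (e i p).2
        have h2 : L i - 1 = j + (L i - (j + 1)) := by omega
        rw [h2, pow_add, mul_assoc] at h1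
        exact mul_left_cancel₀ (pow_pos hc j).ne' h1
    · have h1 := (hs i₀).1.coeff (n - 1)
      have h2 : c ^ n = c ^ (n - 1) * c ^ 1 := by rw [← pow_add, Nat.sub_add_cancel hn1]
      rw [h2, mul_assoc] at h1
      exact mul_left_cancel₀ (pow_pos hc _).ne' h1

end Hurwitz

section CoeffDeriv

variable {f g : ℝ → ℝ[X]} {f' g' : ℝ[X]}

/-- The coefficientwise derivative at `0` of a path of polynomials. -/
def HasCoeffDeriv (f : ℝ → ℝ[X]) (f' : ℝ[X]) : Prop :=
  ∀ j, HasDerivAt (fun t => (f t).coeff j) (f'.coeff j) 0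

theorem HasCoeffDeriv.const (p : ℝ[X]) : HasCoeffDeriv (fun _ => p) 0 := fun _ => by
  simpa using hasDerivAt_const _ _

theorem HasCoeffDeriv.add (hf : HasCoeffDeriv f f') (hg : HasCoeffDeriv g g') :
    HasCoeffDeriv (fun t => f t + g t) (f' + g') := fun j => by
  simpa only [coeff_add] using (hf j).fun_add (hg j)

theorem HasCoeffDeriv.sub (hf : HasCoeffDeriv f f') (hg : HasCoeffDeriv g g') :
    HasCoeffDeriv (fun t => f t - g t) (f' - g') := fun j => by
  simpa only [coeff_sub] using (hf j).fun_sub (hg j)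

theorem HasCoeffDeriv.mul (hf : HasCoeffDeriv f f') (hg : HasCoeffDeriv g g') :
    HasCoeffDeriv (fun t => f t * g t) (f' * g 0 + f 0 * g') := fun j => by
  simp only [coeff_add, coeff_mul, ← Finset.sum_add_distrib]
  exact HasDerivAt.fun_sum fun p _ => (hf p.1).fun_mul (hg p.2)

theorem HasCoeffDeriv.const_mul (p : ℝ[X]) (hf : HasCoeffDeriv f f') :
    HasCoeffDeriv (fun t => p * f t) (p * f') := by
  simpa using (HasCoeffDeriv.const p).mul hf

theorem HasCoeffDeriv.derivative (hf : HasCoeffDeriv f f') :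
    HasCoeffDeriv (fun t => derivative (f t)) (derivative f') := fun j => by
  simp only [coeff_derivative]
  exact (hf (j + 1)).mul_const _

theorem HasCoeffDeriv.C {g : ℝ → ℝ} {g' : ℝ} (hg : HasDerivAt g g' 0) :
    HasCoeffDeriv (fun t => C (g t)) (C g') := fun j => by
  simp only [coeff_C]
  split_ifs
  · exact hg
  · exact hasDerivAt_const _ _

theorem HasCoeffDeriv.pow_add_one (hf : HasCoeffDeriv f f') (m : ℕ) :
    HasCoeffDeriv (fun t => f t ^ (m + 1)) (Polynomial.C ((m : ℝ) + 1) * f 0 ^ m * f') := by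
  induction m with
  | zero => simpa using hf
  | succ m ih =>
    convert ih.mul hf using 1
    · exact funext fun t => pow_succ _ _
    · push_cast
      rw [C_add, map_one]
      ring

theorem HasCoeffDeriv.sum {ι : Type*} (s : Finset ι) {f : ι → ℝ → ℝ[X]} {f' : ι → ℝ[X]}
    (hf : ∀ i, HasCoeffDeriv (f i) (f' i)) :
    HasCoeffDeriv (fun t => ∑ i ∈ s, f i t) (∑ i ∈ s, f' i) := fun j => by
  simp only [finsetSum_coeff]
  exact HasDerivAt.fun_sum fun i _ => hf i j

theorem HasCoeffDeriv.prod {ι : Type*} [DecidableEq ι] (s : Finset ι) {f : ι → ℝ → ℝ[X]} {f' : ι → ℝ[X]}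
    (hf : ∀ i, HasCoeffDeriv (f i) (f' i)) :
    HasCoeffDeriv (fun t => ∏ i ∈ s, f i t) (∑ i ∈ s, (∏ j ∈ s.erase i, f j 0) * f' i) := by
  induction s using Finset.induction_on with
  | empty => simpa using HasCoeffDeriv.const 1
  | insert a s ha ih =>
    simp only [Finset.prod_insert ha]
    convert (hf a).mul ih using 1
    rw [Finset.sum_insert ha, Finset.erase_insert ha, mul_comm, Finset.mul_sum]
    congr 1
    refine Finset.sum_congr rfl fun i hi => ?_
    rw [Finset.erase_insert_of_ne (by rintro rfl; exact ha hi), Finset.prod_insert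
      (fun h => ha (Finset.mem_of_mem_erase h)), mul_assoc]

theorem HasCoeffDeriv.unique (hf : HasCoeffDeriv f f') (hg : HasCoeffDeriv f g') : f' = g' :=
  Polynomial.ext fun j => (hf j).unique (hg j)

theorem HasCoeffDeriv.coeff_eq_zero (hf : HasCoeffDeriv f f') {j : ℕ} {c : ℝ}
    (h : ∀ t, (f t).coeff j = c) : f'.coeff j = 0 := by
  have := hf j
  simp only [h] at this
  exact this.unique (hasDerivAt_const _ _)

end CoeffDeriv

section Hurwitz

variable {k n : ℕ} {l : Fin k → Fin n → ℕ} {L : Fin k → ℕ}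
  (e : ∀ i, (Σ m, Fin (l i m)) ≃ Fin (L i)) (i₀ : Fin k)
  (hn : ∀ i, ∑ m, l i m * ((m : ℕ) + 1) = n)
  (hd : ∑ i, ∑ m, l i m * (m : ℕ) = n - 1) (hn1 : 0 < n) (hL : ∀ i, ∑ m, l i m = L i)
  (x δ : (Σ i : Fin k, Σ m : Fin n, Fin (l i m)) ⊕ Unit → ℝ)

/-- The derivative of `factorPoly` in the direction `δ`. -/
noncomputable def tangentPoly (i : Fin k) (m : Fin n) : ℝ[X] :=
  ∑ j : Fin (l i m), C (δ (Sum.inl ⟨i, m, j⟩)) * X ^ (j : ℕ)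

/-- The derivative of `fullPoly` in the direction `δ` is `ramPoly` times this polynomial. -/
noncomputable def tangentDer (i : Fin k) : ℝ[X] := logDer (factorPoly x i) (tangentPoly δ i)

theorem hasDerivAt_line (q : (Σ i : Fin k, Σ m : Fin n, Fin (l i m)) ⊕ Unit) :
    HasDerivAt (fun t : ℝ => (x + t • δ) q) (δ q) 0 := by
  simp only [Pi.add_apply, Pi.smul_apply, smul_eq_mul]
  simpa using ((hasDerivAt_id (0 : ℝ)).mul_const (δ q)).const_add (x q)

theorem hasCoeffDeriv_factorPoly (i : Fin k) (m : Fin n) :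
    HasCoeffDeriv (fun t => factorPoly (x + t • δ) i m) (tangentPoly δ i m) := by
  rw [← zero_add (tangentPoly δ i m)]
  refine (HasCoeffDeriv.const _).add (HasCoeffDeriv.sum _ fun j => ?_)
  simpa using (HasCoeffDeriv.C (hasDerivAt_line x δ (Sum.inl ⟨i, m, j⟩))).mul
    (HasCoeffDeriv.const (X ^ (j : ℕ)))

theorem hasCoeffDeriv_fullPoly (i : Fin k) :
    HasCoeffDeriv (fun t => fullPoly (x + t • δ) i) (ramPoly x i * tangentDer x δ i) := by
  rw [tangentDer, ramPoly, ← sum_prod_erase_eq_mul_logDer]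
  simpa [fullPoly] using HasCoeffDeriv.prod Finset.univ fun m =>
    (hasCoeffDeriv_factorPoly x δ i m).pow_add_one (m : ℕ)

theorem exists_hasCoeffDeriv_ramPoly (i : Fin k) :
    ∃ D, HasCoeffDeriv (fun t => ramPoly (x + t • δ) i) D := by
  have : ∀ m : Fin n, ∃ D, HasCoeffDeriv (fun t => factorPoly (x + t • δ) i m ^ (m : ℕ)) D := by
    intro m
    rcases Nat.eq_zero_or_eq_succ_pred (m : ℕ) with h | h
    · rw [h]; simpa using ⟨_, HasCoeffDeriv.const 1⟩
    · rw [h]; exact ⟨_, (hasCoeffDeriv_factorPoly x δ i m).pow_add_one _⟩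
  choose D hD using this
  exact ⟨_, HasCoeffDeriv.prod Finset.univ hD⟩

theorem exists_hasCoeffDeriv_critDefect (i : Fin k) :
    ∃ D, HasCoeffDeriv (fun t => critDefect (x + t • δ) i) D := by
  choose D hD using exists_hasCoeffDeriv_ramPoly x δ
  exact ⟨_, (HasCoeffDeriv.sum _ fun m =>
      ((hasCoeffDeriv_factorPoly x δ i m).derivative.const_mul _).mul
        (HasCoeffDeriv.prod _ fun m' => hasCoeffDeriv_factorPoly x δ i m')).sub
    ((HasCoeffDeriv.prod _ hD).const_mul _)⟩

include hn hd hn1 hL in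
theorem fderiv_hurwitzMap_spec (hx : ∀ i, critDefect x i = 0) :
    ∃ Y : ℝ[X], Y.degree < (n - 1 : ℕ) ∧
      (∀ i, ∃ E : ℝ[X],
        ramPoly x i * E = derivative (ramPoly x i * tangentDer x δ i) - Y ∧
        blockPoly e i (fderiv ℝ (hurwitzMap e i₀) x δ) =
          X * E + C ((ramPoly x i * tangentDer x δ i).coeff 0 - δ (Sum.inr ()))) ∧
      fderiv ℝ (hurwitzMap e i₀) x δ (Sum.inr ()) =
        (ramPoly x i₀ * tangentDer x δ i₀).coeff (n - 1) := by
  choose D hD using exists_hasCoeffDeriv_ramPoly x δ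
  choose E hE using exists_hasCoeffDeriv_critDefect x δ
  have h0 : x + (0 : ℝ) • δ = x := by simp
  have hY := (HasCoeffDeriv.prod Finset.univ hD).const_mul (C (n : ℝ))
  set Y := C (n : ℝ) * ∑ i, (∏ j ∈ Finset.univ.erase i, ramPoly (x + (0 : ℝ) • δ) j) * D i
  have hEd : ∀ i, (E i).degree < (L i - 1 : ℕ) := fun i =>
    (degree_lt_iff_coeff_zero _ _).2 fun j hj => (hE i).coeff_eq_zero fun t =>
      (degree_lt_iff_coeff_zero _ _).1 (degree_critDefect_lt (x + t • δ) hn hd hn1 (hL i)) j hj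
  have hline : HasDerivAt (fun t : ℝ => hurwitzMap e i₀ (x + t • δ))
      (fderiv ℝ (hurwitzMap e i₀) x δ) 0 :=
    (((contDiff_hurwitzMap e i₀).differentiable (by simp)) x).hasFDerivAt.hasLineDerivAt δ
  rw [hasDerivAt_pi] at hline
  have hfd : fderiv ℝ (hurwitzMap e i₀) x δ = blockVec e
      (fun i => X * E i + C ((ramPoly x i * tangentDer x δ i).coeff 0 - δ (Sum.inr ())))
      ((ramPoly x i₀ * tangentDer x δ i₀).coeff (n - 1)) := by
    funext q
    refine (hline q).unique ?_
    rcases q with ⟨i, p⟩ | ⟨⟩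
    · exact (((hE i).const_mul X).add (HasCoeffDeriv.C
        ((hasCoeffDeriv_fullPoly x δ i 0).fun_sub (hasDerivAt_line x δ (Sum.inr ()))))) (e i p)
    · exact hasCoeffDeriv_fullPoly x δ i₀ (n - 1)
  refine ⟨Y, ?_, fun i => ⟨E i, ?_, ?_⟩, ?_⟩
  · refine (degree_lt_iff_coeff_zero _ _).2 fun j hj => ?_
    refine hY.coeff_eq_zero (c := n * if j = n - 1 then 1 else 0) fun t => ?_
    rw [coeff_C_mul]
    split_ifs with h
    · rw [h, ← natDegree_prod_ramPoly (x + t • δ) hd, (monic_prod_ramPoly _).coeff_natDegree]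
    · rw [coeff_eq_zero_of_natDegree_lt]
      rw [natDegree_prod_ramPoly _ hd]
      omega
  · have h1 := (hD i).mul (hE i)
    simp only [ramPoly_mul_critDefect, h0, hx, mul_zero, zero_add] at h1
    exact h1.unique ((hasCoeffDeriv_fullPoly x δ i).derivative.sub hY)
  · rw [hfd, blockPoly_blockVec]
    exact degree_X_mul_add_C_lt (one_le_blockSize hn hn1 hL i) (hEd i) _
  · rw [hfd]; rfl

end Hurwitz

section Hurwitz

variable {k n : ℕ} {l : Fin k → Fin n → ℕ} {L : Fin k → ℕ}
  (e : ∀ i, (Σ m, Fin (l i m)) ≃ Fin (L i)) (i₀ : Fin k)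
  (hn : ∀ i, ∑ m, l i m * ((m : ℕ) + 1) = n)
  (hd : ∑ i, ∑ m, l i m * (m : ℕ) = n - 1) (hn1 : 0 < n) (hL : ∀ i, ∑ m, l i m = L i)
  (x : (Σ i : Fin k, Σ m : Fin n, Fin (l i m)) ⊕ Unit → ℝ)

noncomputable def tangentMatrix : Matrix ((Σ i : Fin k, Σ m : Fin n, Fin (l i m)) ⊕ Unit)
    ((Σ i : Fin k, Σ m : Fin n, Fin (l i m)) ⊕ Unit) ℝ :=
  Matrix.fromBlocks (Matrix.blockDiagonal' fun i => blockMatrix (e i) (factorPoly x i)) 0 0 1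

theorem det_tangentMatrix :
    (tangentMatrix e x).det = ∏ i, (blockMatrix (e i) (factorPoly x i)).det := by
  rw [tangentMatrix, Matrix.det_fromBlocks_zero₂₁, Matrix.det_one, mul_one]
  refine det_of_sigma_block _ _ (fun s t h => ?_) fun i a b => ?_
  · exact Matrix.blockDiagonal'_apply_ne _ _ _ h
  · exact Matrix.blockDiagonal'_apply_eq _ _ _ _

theorem coeff_tangentDer (δ : (Σ i : Fin k, Σ m : Fin n, Fin (l i m)) ⊕ Unit → ℝ) (i : Fin k)
    (p : Σ m : Fin n, Fin (l i m)) : (tangentDer x δ i).coeff (e i p) =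
      ∑ s, blockMatrix (e i) (factorPoly x i) p s * δ (Sum.inl ⟨i, s⟩) := by
  rw [tangentDer, logDer, finsetSum_coeff, Fintype.sum_sigma]
  refine Finset.sum_congr rfl fun m _ => ?_
  rw [tangentPoly, Finset.mul_sum, Finset.sum_mul, finsetSum_coeff]
  refine Finset.sum_congr rfl fun j _ => ?_
  rw [blockMatrix, Matrix.of_apply, mul_comm (Polynomial.coeff _ _), ← coeff_C_mul]
  congr 1
  ring

theorem toLin_tangentMatrix (δ : (Σ i : Fin k, Σ m : Fin n, Fin (l i m)) ⊕ Unit → ℝ) :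
    Matrix.toLin' (tangentMatrix e x) δ = blockVec e (tangentDer x δ) (δ (Sum.inr ())) := by
  rw [Matrix.toLin'_apply]
  funext q
  rcases q with ⟨i, p⟩ | ⟨⟩
  · rw [blockVec, Sum.elim_inl, coeff_tangentDer, tangentMatrix, Matrix.mulVec, dotProduct,
      Fintype.sum_sum_type, Fintype.sum_sigma, Finset.sum_eq_single i]
    · simp [Matrix.blockDiagonal'_apply_eq]
    · intro j _ hj
      refine Finset.sum_eq_zero fun s _ => ?_
      rw [Matrix.fromBlocks_apply₁₁, Matrix.blockDiagonal'_apply_ne _ _ _ hj.symm, zero_mul]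
    · simp
  · simp [blockVec, tangentMatrix, Matrix.mulVec, dotProduct]

include hL in
theorem degree_tangentDer_lt
    (δ : (Σ i : Fin k, Σ m : Fin n, Fin (l i m)) ⊕ Unit → ℝ) (i : Fin k) :
    (tangentDer x δ i).degree < L i := by
  rw [tangentDer, logDer]
  refine (degree_sum_le _ _).trans_lt ((Finset.sup_lt_iff (WithBot.bot_lt_coe _)).2 fun m _ => ?_)
  have h1 : (∏ m' ∈ {m}ᶜ, factorPoly x i m').Monic :=
    monic_prod_of_monic _ _ fun m _ => monic_factorPoly x i m
  have h2 : (∏ m' ∈ {m}ᶜ, factorPoly x i m').natDegree = ∑ m' ∈ {m}ᶜ, l i m' := by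
    rw [natDegree_prod_of_monic _ _ fun m _ => monic_factorPoly x i m]
    exact Finset.sum_congr rfl fun m _ => natDegree_factorPoly x i m
  have h3 : (C ((m : ℝ) + 1) * tangentPoly δ i m).degree < l i m :=
    (degree_C_mul (by positivity)).trans_lt (degree_factorPoly_tail_lt δ i m)
  rw [h1.degree_mul, degree_eq_natDegree h1.ne_zero, h2, ← hL i, Fintype.sum_eq_add_sum_compl m,
    Nat.cast_add]
  exact WithBot.add_lt_add_right (WithBot.coe_ne_bot) h3

include hn hd hn1 hL in
theorem det_fderiv_hurwitzMap_sign (hx : ∀ i, critDefect x i = 0)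
    (hco : Pairwise fun i j => IsCoprime (ramPoly x i) (ramPoly x j))
    (hdet : (tangentMatrix e x).det ≠ 0) :
    0 < (fderiv ℝ (hurwitzMap e i₀) x).det * (tangentMatrix e x).det *
      LinearMap.det (refMap e i₀ ((-1) ^ (n - 1)) 0 0) := by
  have hL1 : ∀ i, 1 ≤ L i := fun i => one_le_blockSize hn hn1 hL i
  have hm : ∀ i, (ramPoly x i).natDegree + L i = n - 1 + 1 := fun i => by
    have h1 := hn i
    simp only [mul_add, mul_one, Finset.sum_add_distrib, hL] at h1
    rw [natDegree_ramPoly]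
    omega
  have hinv : (tangentMatrix e x) * (tangentMatrix e x)⁻¹ = 1 :=
    Matrix.mul_nonsing_inv _ (isUnit_iff_ne_zero.2 hdet)
  have key := det_mul_det_refMap_pos (e := e) hL1 i₀ (ramPoly x) (monic_ramPoly x) hco
    (natDegree_prod_ramPoly x hd) hm
    ((fderiv ℝ (hurwitzMap e i₀) x).toLinearMap.comp (Matrix.toLin' (tangentMatrix e x)⁻¹))
    (fun v => ?_)
  · rw [LinearMap.det_comp, LinearMap.det_toLin'] at key
    have h1 : (tangentMatrix e x).det * (tangentMatrix e x)⁻¹.det = 1 := by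
      rw [← Matrix.det_mul, hinv, Matrix.det_one]
    have h2 := mul_pos key (pow_pos (abs_pos.2 hdet) 2)
    rw [sq_abs] at h2
    refine h2.trans_eq ?_
    rw [ContinuousLinearMap.det]
    linear_combination (LinearMap.det (fderiv ℝ (hurwitzMap e i₀) x).toLinearMap *
      LinearMap.det (refMap e i₀ ((-1) ^ (n - 1)) 0 0) * (tangentMatrix e x).det) * h1
  · set δ := Matrix.toLin' (tangentMatrix e x)⁻¹ v with hδ
    have hv : v = blockVec e (tangentDer x δ) (δ (Sum.inr ())) := by
      rw [← toLin_tangentMatrix, hδ, ← LinearMap.comp_apply, ← Matrix.toLin'_mul, hinv,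
        Matrix.toLin'_one, LinearMap.id_apply]
    have hb : ∀ i, blockPoly e i v = tangentDer x δ i := fun i => by
      rw [hv, blockPoly_blockVec _ _ _ _ (degree_tangentDer_lt hL x δ i)]
    have hv' : v (Sum.inr ()) = δ (Sum.inr ()) := by rw [hv]; rfl
    obtain ⟨Y, hY, hE, h0⟩ := fderiv_hurwitzMap_spec e i₀ hn hd hn1 hL x δ hx
    refine ⟨Y, hY, fun i => ?_, ?_⟩
    · rw [hb, hv']
      exact hE i
    · rw [← coeff_mul_blockPoly_of_monic (monic_ramPoly x i₀) i₀ (hm i₀) (hL1 i₀), hb]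
      exact h0

end Hurwitz

section Hurwitz

variable {k n : ℕ} {l : Fin k → Fin n → ℕ} {w : Fin k → ℝ} (hw : Function.Injective w)
  {x : (Σ i : Fin k, Σ m : Fin n, Fin (l i m)) ⊕ Unit → ℝ}
  (hx : ∀ i, critDefect x i = 0 ∧ (fullPoly x i).coeff 0 = x (Sum.inr ()) - w i)

include hw hx in
theorem isCoprime_fullPoly {i j : Fin k} (hij : i ≠ j) :
    IsCoprime (fullPoly x i) (fullPoly x j) := by
  have h0 : w j - w i ≠ 0 := sub_ne_zero.2 (hw.ne hij.symm)
  refine ⟨C (w j - w i)⁻¹, -C (w j - w i)⁻¹, ?_⟩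
  have h := fullPoly_sub_fullPoly hx i j
  rw [neg_mul, ← sub_eq_add_neg, ← mul_sub,
    show fullPoly x i - fullPoly x j = C (w j - w i) by rw [C_sub]; linear_combination h,
    ← C_mul, inv_mul_cancel₀ h0, C_1]

include hw hx in
theorem isCoprime_ramPoly : Pairwise fun i j => IsCoprime (ramPoly x i) (ramPoly x j) :=
  fun i j hij => (isCoprime_fullPoly hw hx hij).of_isCoprime_of_dvd_left
    ⟨_, fullPoly_eq x i⟩ |>.of_isCoprime_of_dvd_right ⟨_, fullPoly_eq x j⟩

theorem aeval_fullPoly_eq_zero_iff {i : Fin k} {a : ℂ} :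
    aeval a (fullPoly x i) = 0 ↔ ∃ m, aeval a (factorPoly x i m) = 0 := by
  rw [fullPoly, map_prod, Finset.prod_eq_zero_iff]
  simp

include hw hx in
theorem aeval_fullPoly_ne_zero {i j : Fin k} (hij : i ≠ j) {a : ℂ}
    (h : aeval a (fullPoly x i) = 0) : aeval a (fullPoly x j) ≠ 0 := fun h' => by
  obtain ⟨u, v, huv⟩ := isCoprime_fullPoly hw hx hij
  have := congrArg (aeval a) huv
  simp [h, h'] at this

include hw hx in
theorem aeval_logDer_ne_zero (hn : 0 < n) {i : Fin k} {a : ℂ} (h : aeval a (fullPoly x i) = 0) :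
    aeval a (logDer (factorPoly x i) fun m => derivative (factorPoly x i m)) ≠ 0 := by
  have h1 := (hx i).1
  rw [critDefect, sub_eq_zero] at h1
  rw [h1, map_mul, map_prod, aeval_C, mul_ne_zero_iff, Finset.prod_ne_zero_iff]
  refine ⟨by simpa using hn.ne', fun j hj h2 => ?_⟩
  rw [Finset.mem_compl, Finset.mem_singleton] at hj
  exact aeval_fullPoly_ne_zero hw hx (Ne.symm hj) h
    (aeval_fullPoly_eq_zero_of_ramPoly x h2)

theorem mem_roots_map_iff {i : Fin k} {m : Fin n} {a : ℂ} :
    a ∈ ((factorPoly x i m).map (algebraMap ℝ ℂ)).roots ↔ aeval a (factorPoly x i m) = 0 := by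
  rw [mem_roots ((monic_factorPoly x i m).map _).ne_zero, IsRoot.def, eval_map_algebraMap]

include hw hx in
theorem nodup_roots_factorPoly (hn : 0 < n) (i : Fin k) (m : Fin n) :
    ((factorPoly x i m).map (algebraMap ℝ ℂ)).roots.Nodup := by
  rw [Multiset.nodup_iff_count_le_one]
  intro a
  by_contra! h
  rw [count_roots, one_lt_rootMultiplicity_iff_isRoot ((monic_factorPoly x i m).map _).ne_zero,
    IsRoot.def, IsRoot.def, derivative_map, eval_map_algebraMap, eval_map_algebraMap] at h
  refine aeval_logDer_ne_zero hw hx hn (aeval_fullPoly_eq_zero_iff.2 ⟨m, h.1⟩) ?_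
  rw [logDer, map_sum]
  refine Finset.sum_eq_zero fun m' _ => ?_
  rw [map_mul, map_mul, map_prod]
  by_cases hm : m' = m
  · rw [hm, h.2, mul_zero, zero_mul]
  · rw [Finset.prod_eq_zero (i := m) (by simpa using Ne.symm hm) h.1, mul_zero]

include hw hx in
theorem disjoint_roots_factorPoly (hn : 0 < n) (i : Fin k) (m m' : Fin n) (hm : m ≠ m') (a : ℂ)
    (ha : a ∈ ((factorPoly x i m).map (algebraMap ℝ ℂ)).roots) :
    a ∉ ((factorPoly x i m').map (algebraMap ℝ ℂ)).roots := fun ha' => by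
  rw [mem_roots_map_iff] at ha ha'
  refine aeval_logDer_ne_zero hw hx hn (aeval_fullPoly_eq_zero_iff.2 ⟨m, ha⟩) ?_
  rw [logDer, map_sum]
  refine Finset.sum_eq_zero fun m₁ _ => ?_
  rw [map_mul, map_prod]
  by_cases h : m₁ = m
  · rw [Finset.prod_eq_zero (i := m') (by simpa [h] using Ne.symm hm) ha', mul_zero]
  · rw [Finset.prod_eq_zero (i := m) (by simpa using Ne.symm h) ha, mul_zero]

include hw hx in
theorem det_tangentMatrix_sign (hn : 0 < n) {L : Fin k → ℕ}
    (e : ∀ i, (Σ m, Fin (l i m)) ≃ Fin (L i))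
    (he : ∀ i s t, e i s < e i t ↔ s.1 < t.1 ∨ (s.1 = t.1 ∧ (s.2 : ℕ) < t.2)) :
    0 < (tangentMatrix e x).det * ∏ i, ∏ m, ∏ m' > m, ((-1) ^ (l i m * l i m') *
      (-1) ^ (rootPairs (factorPoly x i m') (factorPoly x i m)).card) := by
  rw [det_tangentMatrix, ← Finset.prod_mul_distrib]
  exact Finset.prod_pos fun i _ => det_blockMatrix_sign (he i) _ (monic_factorPoly x i)
    (natDegree_factorPoly x i) (nodup_roots_factorPoly hw hx hn i)
    (disjoint_roots_factorPoly hw hx hn i)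

end Hurwitz

section Multiplicity

theorem rootMultiplicity_prod_pow {K : Type*} [Field K] {N : ℕ} {Q : Fin N → K[X]}
    (hQ : ∀ m, Q m ≠ 0) (a : K) : (∏ m, Q m ^ ((m : ℕ) + 1)).rootMultiplicity a =
      ∑ m : Fin N, ((m : ℕ) + 1) * (Q m).roots.count a := by
  rw [← count_roots, roots_prod _ _ (Finset.prod_ne_zero_iff.2 fun m _ => pow_ne_zero _ (hQ m)),
    Multiset.count_bind]
  simp only [roots_pow, Multiset.count_nsmul]
  rfl

theorem rootMultiplicity_prod_pow_of_mem {K : Type*} [Field K] {N : ℕ} {Q : Fin N → K[X]}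
    (hQ : ∀ m, Q m ≠ 0) (hs : ∀ m, (Q m).roots.Nodup)
    (hd : ∀ m m', m ≠ m' → ∀ a ∈ (Q m).roots, a ∉ (Q m').roots) {a : K} {m : Fin N}
    (ha : a ∈ (Q m).roots) : (∏ m, Q m ^ ((m : ℕ) + 1)).rootMultiplicity a = m + 1 := by
  rw [rootMultiplicity_prod_pow hQ, Finset.sum_eq_single m, Multiset.count_eq_one_of_mem (hs m) ha,
    mul_one]
  · intro m' _ hm
    rw [Multiset.count_eq_zero_of_notMem (hd m m' hm.symm a ha), mul_zero]
  · simp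

end Multiplicity

section Hurwitz

variable {k n : ℕ} {l : Fin k → Fin n → ℕ} {w : Fin k → ℝ} (hw : Function.Injective w)
  {x : (Σ i : Fin k, Σ m : Fin n, Fin (l i m)) ⊕ Unit → ℝ}
  (hx : ∀ i, critDefect x i = 0 ∧ (fullPoly x i).coeff 0 = x (Sum.inr ()) - w i)
  (hn : 0 < n)

include hw hx hn in
theorem rootMultiplicity_map_fullPoly {i : Fin k} {m : Fin n} {a : ℂ}
    (ha : aeval a (factorPoly x i m) = 0) :
    ((fullPoly x i).map (algebraMap ℝ ℂ)).rootMultiplicity a = m + 1 := by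
  rw [fullPoly, Polynomial.map_prod]
  simp only [Polynomial.map_pow]
  exact rootMultiplicity_prod_pow_of_mem (Q := fun m => (factorPoly x i m).map (algebraMap ℝ ℂ))
    (fun m => ((monic_factorPoly x i m).map _).ne_zero) (nodup_roots_factorPoly hw hx hn i)
    (disjoint_roots_factorPoly hw hx hn i) (mem_roots_map_iff.2 ha)

theorem aeval_ofReal_eq_zero_iff {p : ℝ[X]} {a : ℝ} :
    aeval (algebraMap ℝ ℂ a) p = 0 ↔ p.eval a = 0 := by
  rw [aeval_algebraMap_apply, coe_aeval_eq_eval, FaithfulSMul.algebraMap_eq_zero_iff]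

include hw hx hn in
theorem rootMultiplicity_fullPoly {i : Fin k} {m : Fin n} {a : ℝ}
    (ha : (factorPoly x i m).eval a = 0) : (fullPoly x i).rootMultiplicity a = m + 1 := by
  rw [eq_rootMultiplicity_map (algebraMap ℝ ℂ).injective]
  exact rootMultiplicity_map_fullPoly hw hx hn (aeval_ofReal_eq_zero_iff.2 ha)

include hw hx hn in
theorem card_disorders {P : ℝ[X]} (hP : ∀ i, P = fullPoly x i + C (w i)) (i₀ : Fin k)
    (hn' : ∀ i, ∑ m, l i m * ((m : ℕ) + 1) = n) :
    Nat.card (disorders P) =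
      ∑ i, ∑ m, ∑ m' > m, (rootPairs (factorPoly x i m') (factorPoly x i m)).card := by
  set T : Finset (Fin k × Fin n × Fin n) := Finset.univ.filter fun q => q.2.1 < q.2.2
  set f : Fin k × Fin n × Fin n → Finset (ℝ × ℝ) := fun q =>
    rootPairs (factorPoly x q.1 q.2.2) (factorPoly x q.1 q.2.1)
  have hmem : ∀ q a b, (a, b) ∈ f q ↔ ((factorPoly x q.1 q.2.2).eval a = 0 ∧
      (factorPoly x q.1 q.2.1).eval b = 0) ∧ a < b := fun q a b => by
    simp only [f, rootPairs, Finset.mem_filter, Finset.mem_product, Multiset.mem_toFinset,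
      mem_roots (monic_factorPoly x _ _).ne_zero, IsRoot.def]
  have hval : ∀ i (a : ℝ), P.eval a = w i ↔ ∃ m, (factorPoly x i m).eval a = 0 := fun i a => by
    simp only [← aeval_ofReal_eq_zero_iff, ← aeval_fullPoly_eq_zero_iff]
    rw [aeval_ofReal_eq_zero_iff, hP i, eval_add, eval_C, add_eq_right]
  have hmult : ∀ i m (a : ℝ), (factorPoly x i m).eval a = 0 →
      (P - C (P.eval a)).rootMultiplicity a = m + 1 := fun i m a ha => by
    rw [(hval i a).2 ⟨m, ha⟩, hP i, add_sub_cancel_right]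
    exact rootMultiplicity_fullPoly hw hx hn ha
  have huniq : ∀ i m i' m' (a : ℝ), (factorPoly x i m).eval a = 0 →
      (factorPoly x i' m').eval a = 0 → i = i' ∧ m = m' := fun i m i' m' a h h' =>
    ⟨hw (((hval i a).2 ⟨m, h⟩).symm.trans ((hval i' a).2 ⟨m', h'⟩)), Fin.ext (by
      have := (hmult i m a h).symm.trans (hmult i' m' a h')
      omega)⟩
  have hset : disorders P = ↑(T.biUnion f) := by
    ext ⟨a, b⟩
    rw [Finset.coe_biUnion, Set.mem_iUnion₂]
    constructor
    · rintro ⟨h1, h2, h3⟩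
      dsimp only at h1 h2 h3
      have hP0 : ∀ c : ℝ, P - C c ≠ 0 := fun c h => by
        have h4 := natDegree_fullPoly x i₀
        rw [hn' i₀, ← natDegree_add_C (a := w i₀), ← hP i₀, sub_eq_zero.1 h, natDegree_C] at h4
        exact hn.ne h4
      have hb : 0 < (P - C (P.eval b)).rootMultiplicity b :=
        (rootMultiplicity_pos (hP0 _)).2 (by simp)
      have ha : 1 < (P - C (P.eval a)).rootMultiplicity a := by omega
      have ha := ((one_lt_rootMultiplicity_iff_isRoot (hP0 _)).1 ha).2
      rw [derivative_sub, derivative_C, sub_zero, hP i₀, derivative_add, derivative_C, add_zero,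
        derivative_eq_of_critDefect_eq_zero (hx i₀).1, IsRoot.def, eval_mul, eval_C, eval_prod,
        mul_eq_zero, Nat.cast_eq_zero, or_iff_right hn.ne', Finset.prod_eq_zero_iff] at ha
      obtain ⟨i, -, hi⟩ := ha
      rw [← aeval_ofReal_eq_zero_iff] at hi
      obtain ⟨m', hm'⟩ :=
        aeval_fullPoly_eq_zero_iff.1 (aeval_fullPoly_eq_zero_of_ramPoly x hi)
      rw [aeval_ofReal_eq_zero_iff] at hm'
      obtain ⟨m, hm⟩ := (hval i b).1 (h2.symm.trans ((hval i a).2 ⟨m', hm'⟩))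
      rw [hmult i m b hm, hmult i m' a hm'] at h3
      refine ⟨(i, m, m'), ?_, (hmem _ _ _).2 ⟨⟨hm', hm⟩, h1⟩⟩
      simp only [T, Finset.coe_filter, Finset.mem_univ, true_and, Set.mem_ofPred_eq, Fin.lt_def]
      omega
    · rintro ⟨⟨i, m, m'⟩, hq, hab⟩
      obtain ⟨⟨ha, hb⟩, h1⟩ := (hmem _ _ _).1 hab
      simp only [T, Finset.coe_filter, Finset.mem_univ, true_and, Set.mem_ofPred_eq, Fin.lt_def]
        at hq ha hb
      refine ⟨h1, ((hval i a).2 ⟨m', ha⟩).trans ((hval i b).2 ⟨m, hb⟩).symm, ?_⟩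
      dsimp only
      rw [hmult i m b hb, hmult i m' a ha]
      omega
  rw [hset, Nat.card_coe_set_eq, Set.ncard_coe_finset, Finset.card_biUnion]
  · simp only [T, Finset.sum_filter, Fintype.sum_prod_type]
    refine Finset.sum_congr rfl fun i _ => Finset.sum_congr rfl fun m _ => ?_
    rw [← Finset.sum_filter]
    exact Finset.sum_congr (by ext; simp) fun _ _ => rfl
  · rintro ⟨i, m₁, m₂⟩ - ⟨i', m₁', m₂'⟩ - hne
    rw [Function.onFun, Finset.disjoint_left]
    rintro ⟨a, b⟩ h h'
    rw [hmem] at h h'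
    obtain ⟨rfl, rfl⟩ := huniq _ _ _ _ a h.1.1 h'.1.1
    obtain ⟨-, rfl⟩ := huniq _ _ _ _ b h.1.2 h'.1.2
    exact hne rfl

end Hurwitz

section Hurwitz

variable {k n : ℕ} {l : Fin k → Fin n → ℕ} {L : Fin k → ℕ}
  (e : ∀ i, (Σ m, Fin (l i m)) ≃ Fin (L i)) (i₀ : Fin k)
  (he : ∀ i s t, e i s < e i t ↔ s.1 < t.1 ∨ (s.1 = t.1 ∧ (s.2 : ℕ) < t.2))
  (hn : ∀ i, ∑ m, l i m * ((m : ℕ) + 1) = n)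
  (hd : ∑ i, ∑ m, l i m * (m : ℕ) = n - 1) (hn1 : 0 < n) (hL : ∀ i, ∑ m, l i m = L i)
  {w : Fin k → ℝ} (hw : Function.Injective w)
  {x : (Σ i : Fin k, Σ m : Fin n, Fin (l i m)) ⊕ Unit → ℝ}
  (hx : hurwitzMap e i₀ x = hurwitzTarget e w)

/-- The polynomial with branch points `w` corresponding to a point of the fibre over `w`. -/
noncomputable def branchedPoly (i₀ : Fin k) (w : Fin k → ℝ)
    (x : (Σ i : Fin k, Σ m : Fin n, Fin (l i m)) ⊕ Unit → ℝ) : ℝ[X] :=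
  fullPoly x i₀ + C (w i₀)

/-- The sign relating the orientation of the map `hurwitzMap` to the sign of polynomials. -/
noncomputable def orientationSign : SignType :=
  SignType.sign (∏ i, ∏ m, ∏ m' > m, (-1 : ℝ) ^ (l i m * l i m')) *
    SignType.sign (LinearMap.det (refMap e i₀ ((-1) ^ (n - 1)) 0 0))

theorem eq_mul_mul_of_sign_mul_pos {D T ρ S E : ℝ} (h1 : 0 < D * T * ρ) (h2 : 0 < T * (S * E)) :
    SignType.sign D = SignType.sign S * SignType.sign ρ * SignType.sign E ∧ SignType.sign S *
      SignType.sign ρ ≠ 0 := by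
  have h1 := sign_pos h1
  have h2 := sign_pos h2
  simp only [sign_mul] at h1 h2
  generalize SignType.sign D = d at *
  generalize SignType.sign T = t at *
  generalize SignType.sign ρ = r at *
  generalize SignType.sign S = s at *
  generalize SignType.sign E = ε at *
  revert d t r s ε
  decide

include he hn hd hn1 hL hw hx in
theorem sign_det_fderiv_hurwitzMap :
    (SignType.sign (fderiv ℝ (hurwitzMap e i₀) x).det : ℤ) =
        orientationSign e i₀ * epsilonP (branchedPoly i₀ w x) ∧
      orientationSign e i₀ ≠ 0 := by
  have hx1 := ((hurwitzMap_eq_target_iff e i₀ hn hd hn1 hL x w).1 hx).1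
  have hT := det_tangentMatrix_sign hw hx1 hn1 e he
  have hD := det_fderiv_hurwitzMap_sign e i₀ hn hd hn1 hL x (fun i => (hx1 i).1)
    (isCoprime_ramPoly hw hx1) (left_ne_zero_of_mul hT.ne')
  simp only [Finset.prod_mul_distrib] at hT
  obtain ⟨h1, h2⟩ := eq_mul_mul_of_sign_mul_pos hD hT
  refine ⟨?_, h2⟩
  rw [h1, epsilonP, card_disorders (P := branchedPoly i₀ w x) hw hx1 hn1 (fun i => fullPoly_sub_fullPoly hx1 i₀ i) i₀ hn,
    orientationSign, SignType.coe_mul]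
  congr 1
  simp only [Finset.prod_pow_eq_pow_sum]
  rcases neg_one_pow_eq_or ℝ (∑ i, ∑ m, ∑ m' > m,
    (rootPairs (factorPoly x i m') (factorPoly x i m)).card) with h | h
  · rw [h, (neg_one_pow_eq_one_iff_even (by norm_num)).2
      ((neg_one_pow_eq_one_iff_even (R := ℝ) (by norm_num)).1 h)]
    simp
  · rw [h, (neg_one_pow_eq_neg_one_iff_odd (by norm_num)).2
      ((neg_one_pow_eq_neg_one_iff_odd (R := ℝ) (by norm_num)).1 h)]
    simp [sign_neg]

end Hurwitz

section Partition

theorem sum_count_mul {n : ℕ} (f : ℕ → ℕ) {Λ : Multiset ℕ} (h : ∀ a ∈ Λ, a ≠ 0 ∧ a ≤ n) :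
    ∑ m : Fin n, Λ.count ((m : ℕ) + 1) * f (m + 1) = (Λ.map f).sum := by
  induction Λ using Multiset.induction_on with
  | empty => simp
  | cons a Λ ih =>
    obtain ⟨h0, h1⟩ := h a (Multiset.mem_cons_self a Λ)
    simp only [Multiset.count_cons, add_mul, Finset.sum_add_distrib, Multiset.map_cons,
      Multiset.sum_cons]
    rw [ih fun b hb => h b (Multiset.mem_cons_of_mem hb), add_comm, Finset.sum_eq_single
      ⟨a - 1, by omega⟩]
    · simp [Nat.sub_add_cancel (Nat.pos_of_ne_zero h0)]
    · intro m _ hm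
      rw [if_neg, zero_mul]
      rintro rfl
      exact hm (Fin.ext rfl)
    · simp

theorem IsPartitionOf.mem {n : ℕ} {Λ : Multiset ℕ} (h : IsPartitionOf n Λ) :
    ∀ a ∈ Λ, a ≠ 0 ∧ a ≤ n := fun a ha =>
  ⟨fun h0 => h.2 (h0 ▸ ha), (Multiset.single_le_sum (fun _ _ => Nat.zero_le _) a ha).trans_eq h.1⟩

theorem IsPartitionOf.sum_count {n : ℕ} {Λ : Multiset ℕ} (h : IsPartitionOf n Λ) :
    ∑ m : Fin n, Λ.count ((m : ℕ) + 1) = Multiset.card Λ := by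
  simpa using sum_count_mul (fun _ => 1) h.mem

theorem IsPartitionOf.sum_count_mul_succ {n : ℕ} {Λ : Multiset ℕ} (h : IsPartitionOf n Λ) :
    ∑ m : Fin n, Λ.count ((m : ℕ) + 1) * ((m : ℕ) + 1) = n := by
  have := sum_count_mul id h.mem
  rw [Multiset.map_id, h.1] at this
  exact this

theorem IsPartitionOf.ext {n : ℕ} {Λ Λ' : Multiset ℕ} (h : IsPartitionOf n Λ)
    (h' : IsPartitionOf n Λ')
    (hc : ∀ m : Fin n, Λ.count ((m : ℕ) + 1) = Λ'.count ((m : ℕ) + 1)) : Λ = Λ' := by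
  ext a
  by_cases ha : a ≠ 0 ∧ a ≤ n
  · have := hc ⟨a - 1, by omega⟩
    rwa [show a - 1 + 1 = a by omega] at this
  · rw [Multiset.count_eq_zero_of_notMem fun h1 => ha (h.mem a h1),
      Multiset.count_eq_zero_of_notMem fun h1 => ha (h'.mem a h1)]

end Partition

section RamificationType

/-- The roots of multiplicity `c`. -/
noncomputable def rootsOfMultiplicity (q : ℂ[X]) (c : ℕ) : Finset ℂ :=
  q.roots.toFinset.filter fun a => q.rootMultiplicity a = c

theorem isPartitionOf_multiplicities {n : ℕ} {q : ℂ[X]} (hq : q.natDegree = n) (hq0 : q ≠ 0) :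
    IsPartitionOf n (q.roots.toFinset.val.map fun a => q.rootMultiplicity a) := by
  constructor
  · rw [← hq, ← splits_iff_card_roots.1 (IsAlgClosed.splits q), ← Multiset.toFinset_sum_count_eq]
    simp only [count_roots]
    rfl
  · rw [Multiset.mem_map]
    rintro ⟨a, ha, h⟩
    rw [Finset.mem_val, Multiset.mem_toFinset, mem_roots hq0] at ha
    exact ((rootMultiplicity_pos hq0).2 ha).ne' h

theorem count_multiplicities (q : ℂ[X]) (c : ℕ) :
    (q.roots.toFinset.val.map fun a => q.rootMultiplicity a).count c =
      (rootsOfMultiplicity q c).card := by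
  rw [Multiset.count_map, rootsOfMultiplicity, Finset.card_def, Finset.filter_val]
  simp only [eq_comm]

theorem ramType_eq (P : ℝ[X]) (w : ℝ) : ramType P w =
    ((P - C w).map (algebraMap ℝ ℂ)).roots.toFinset.val.map fun a =>
      ((P - C w).map (algebraMap ℝ ℂ)).rootMultiplicity a := by
  rw [ramType, Polynomial.map_sub, map_C]
  rfl

theorem ramType_eq_iff {n : ℕ} {P : ℝ[X]} (hn : P.natDegree = n) (hn1 : 0 < n)
    {w : ℝ} {Λ : Multiset ℕ} (hΛ : IsPartitionOf n Λ) : ramType P w = Λ ↔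
      ∀ m : Fin n, (rootsOfMultiplicity ((P - C w).map (algebraMap ℝ ℂ)) (m + 1)).card =
        Λ.count ((m : ℕ) + 1) := by
  have h1 : (P - C w).natDegree = n := by rw [natDegree_sub_C, hn]
  have h2 : (P - C w).map (algebraMap ℝ ℂ) ≠ 0 := by
    rw [Polynomial.map_ne_zero_iff (algebraMap ℝ ℂ).injective]
    rintro h
    rw [h, natDegree_zero] at h1
    exact hn1.ne h1
  rw [ramType_eq]
  simp only [← count_multiplicities]
  exact ⟨fun h m => by rw [h], fun h => (isPartitionOf_multiplicities
    ((natDegree_map _).trans h1) h2).ext hΛ h⟩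

theorem exists_map_eq_prod_of_conj {s : Finset ℂ} (hs : ∀ a ∈ s, (starRingEnd ℂ) a ∈ s) :
    ∃ Q : ℝ[X], Q.map (algebraMap ℝ ℂ) = ∏ a ∈ s, (X - C a) ∧ Q.natDegree = s.card ∧ Q.Monic := by
  have hconj : (∏ a ∈ s, (X - C a)).map (starRingEnd ℂ) = ∏ a ∈ s, (X - C a) := by
    rw [Polynomial.map_prod]
    refine Finset.prod_nbij (starRingEnd ℂ) hs (star_injective.injOn) (fun a ha => ?_)
      fun a _ => by simp
    exact ⟨_, hs a ha, Complex.conj_conj a⟩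
  have hl : (∏ a ∈ s, (X - C a)) ∈ lifts (algebraMap ℝ ℂ) := by
    rw [lifts_iff_coeff_lifts]
    intro j
    have := congrArg (fun p => coeff p j) hconj
    simp only [coeff_map] at this
    obtain ⟨r, hr⟩ := Complex.conj_eq_iff_real.1 this
    exact ⟨r, hr.symm⟩
  obtain ⟨Q, h1, h2, h3⟩ := lifts_and_natDegree_eq_and_monic hl (monic_prod_X_sub_C id s)
  exact ⟨Q, h1, h2.trans (natDegree_finsetProd_X_sub_C_eq_card s id), h3⟩

theorem eq_prod_rootsOfMultiplicity {n : ℕ} {q : ℂ[X]} (hq : q.Monic) (hn : q.natDegree = n) :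
    q = ∏ m : Fin n, (∏ a ∈ rootsOfMultiplicity q (m + 1), (X - C a)) ^ ((m : ℕ) + 1) := by
  have hpos : ∀ a ∈ q.roots.toFinset, 0 < q.rootMultiplicity a := fun a ha =>
    (rootMultiplicity_pos hq.ne_zero).2
      ((mem_roots hq.ne_zero).1 (Multiset.mem_toFinset.1 ha))
  have hle : ∀ a, q.rootMultiplicity a ≤ n := fun a => by
    rw [← count_roots, ← hn]
    exact (Multiset.count_le_card _ _).trans (card_roots' q)
  nth_rewrite 1 [(IsAlgClosed.splits q).eq_prod_roots_of_monic hq]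
  rw [prod_multiset_root_eq_finset_root, ← Finset.prod_fiberwise_of_maps_to
    (g := fun a => q.rootMultiplicity a - 1) (t := Finset.range n), Finset.prod_range]
  · refine Finset.prod_congr rfl fun m _ => ?_
    rw [← Finset.prod_pow]
    have : q.roots.toFinset.filter (fun a => q.rootMultiplicity a - 1 = m) =
        rootsOfMultiplicity q (m + 1) := by
      refine Finset.filter_congr fun a ha => ?_
      have := hpos a ha
      omega
    rw [this]
    refine Finset.prod_congr rfl fun a ha => ?_
    rw [(Finset.mem_filter.1 ha).2]
  · intro a ha
    have h1 := hpos a ha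
    have h2 := hle a
    rw [Finset.mem_range]
    omega

theorem conj_mem_rootsOfMultiplicity {p : ℝ[X]} {c : ℕ} {a : ℂ}
    (ha : a ∈ rootsOfMultiplicity (p.map (algebraMap ℝ ℂ)) c) :
    (starRingEnd ℂ) a ∈ rootsOfMultiplicity (p.map (algebraMap ℝ ℂ)) c := by
  have hp : (p.map (algebraMap ℝ ℂ)).map (starRingEnd ℂ) = p.map (algebraMap ℝ ℂ) := by
    rw [Polynomial.map_map]
    congr 1
    ext r
    exact Complex.conj_ofReal r
  rw [rootsOfMultiplicity, Finset.mem_filter, Multiset.mem_toFinset] at ha ⊢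
  have h1 : (p.map (algebraMap ℝ ℂ)).rootMultiplicity ((starRingEnd ℂ) a) = c := by
    rw [← ha.2, eq_rootMultiplicity_map (starRingEnd ℂ).injective a, hp]
  refine ⟨?_, h1⟩
  rw [← Multiset.count_pos, count_roots, h1, ← ha.2, ← count_roots, Multiset.count_pos]
  exact ha.1

end RamificationType

section Hurwitz

variable {k n : ℕ} {l : Fin k → Fin n → ℕ} {L : Fin k → ℕ}
  (e : ∀ i, (Σ m, Fin (l i m)) ≃ Fin (L i)) (i₀ : Fin k)
  (hn : ∀ i, ∑ m, l i m * ((m : ℕ) + 1) = n)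
  (hd : ∑ i, ∑ m, l i m * (m : ℕ) = n - 1) (hn1 : 0 < n) (hL : ∀ i, ∑ m, l i m = L i)
  {w : Fin k → ℝ} (hw : Function.Injective w)

section Fiber

variable {x : (Σ i : Fin k, Σ m : Fin n, Fin (l i m)) ⊕ Unit → ℝ}
  (hx : ∀ i, critDefect x i = 0 ∧ (fullPoly x i).coeff 0 = x (Sum.inr ()) - w i)

include hx in
theorem branchedPoly_sub_C (i : Fin k) : branchedPoly i₀ w x - C (w i) = fullPoly x i := by
  rw [branchedPoly, fullPoly_sub_fullPoly hx i₀ i, add_sub_cancel_right]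

include hw hx hn1 in
theorem rootsOfMultiplicity_fullPoly (i : Fin k) (m : Fin n) :
    rootsOfMultiplicity ((fullPoly x i).map (algebraMap ℝ ℂ)) (m + 1) =
      ((factorPoly x i m).map (algebraMap ℝ ℂ)).roots.toFinset := by
  ext a
  rw [rootsOfMultiplicity, Finset.mem_filter, Multiset.mem_toFinset, Multiset.mem_toFinset,
    mem_roots_map_iff, mem_roots ((monic_fullPoly x i).map _).ne_zero, IsRoot.def,
    eval_map_algebraMap, aeval_fullPoly_eq_zero_iff]
  constructor
  · rintro ⟨⟨m', hm'⟩, h⟩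
    rw [rootMultiplicity_map_fullPoly hw hx hn1 hm', Nat.add_right_cancel_iff, ← Fin.ext_iff] at h
    rwa [← h]
  · exact fun h => ⟨⟨m, h⟩, rootMultiplicity_map_fullPoly hw hx hn1 h⟩

include hw hx hn1 in
theorem map_factorPoly_eq_prod (i : Fin k) (m : Fin n) :
    (factorPoly x i m).map (algebraMap ℝ ℂ) =
      ∏ a ∈ rootsOfMultiplicity ((fullPoly x i).map (algebraMap ℝ ℂ)) (m + 1), (X - C a) := by
  rw [rootsOfMultiplicity_fullPoly hn1 hw hx, Finset.prod, Multiset.toFinset_val,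
    (nodup_roots_factorPoly hw hx hn1 i m).dedup]
  exact (IsAlgClosed.splits _).eq_prod_roots_of_monic ((monic_factorPoly x i m).map _)

end Fiber

variable {Λ : Fin k → Multiset ℕ} (hΛ : ∀ i, IsPartitionOf n (Λ i))
  (hl : ∀ i m, l i m = (Λ i).count ((m : ℕ) + 1))

include hn hd hn1 hL in
theorem injOn_branchedPoly (hw : Function.Injective w) :
    Set.InjOn (branchedPoly i₀ w) (hurwitzMap e i₀ ⁻¹' {hurwitzTarget e w}) := by
  intro x hx y hy hxy
  have hx := ((hurwitzMap_eq_target_iff e i₀ hn hd hn1 hL x w).1 hx).1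
  have hy := ((hurwitzMap_eq_target_iff e i₀ hn hd hn1 hL y w).1 hy).1
  have hfull : ∀ i, fullPoly x i = fullPoly y i := fun i => by
    rw [← branchedPoly_sub_C i₀ hx, ← branchedPoly_sub_C i₀ hy, hxy]
  funext q
  rcases q with ⟨i, m, j⟩ | ⟨⟩
  · rw [← coeff_factorPoly x i m j, ← coeff_factorPoly y i m j]
    congr 1
    refine map_injective _ (algebraMap ℝ ℂ).injective ?_
    rw [map_factorPoly_eq_prod hn1 hw hx, map_factorPoly_eq_prod hn1 hw hy, hfull]
  · have h1 := (hx i₀).2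
    rw [hfull, (hy i₀).2] at h1
    linarith

include hn hd hn1 hL hΛ hl in
theorem mapsTo_branchedPoly (hw : Function.Injective w) (hn2 : 1 < n) :
    Set.MapsTo (branchedPoly i₀ w) (hurwitzMap e i₀ ⁻¹' {hurwitzTarget e w}) (sSet n Λ w) := by
  intro x hx
  obtain ⟨hx, hx0⟩ := (hurwitzMap_eq_target_iff e i₀ hn hd hn1 hL x w).1 hx
  have hdeg : (branchedPoly i₀ w x).natDegree = n := by
    rw [branchedPoly, natDegree_add_C, natDegree_fullPoly, hn]
  refine ⟨⟨hdeg, ?_, ?_⟩, fun i => ?_⟩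
  · refine (monic_fullPoly x i₀).add_of_left (degree_C_le.trans_lt ?_)
    rw [degree_eq_natDegree (monic_fullPoly x i₀).ne_zero, natDegree_fullPoly, hn]
    exact_mod_cast hn1
  · rw [branchedPoly, coeff_add, hx0, coeff_C_of_ne_zero (by omega), add_zero]
  · rw [ramType_eq_iff hdeg hn1 (hΛ i)]
    intro m
    rw [branchedPoly_sub_C i₀ hx, rootsOfMultiplicity_fullPoly hn1 hw hx,
      Multiset.toFinset_card_of_nodup (nodup_roots_factorPoly hw hx hn1 i m),
      splits_iff_card_roots.1 (IsAlgClosed.splits _), natDegree_map, natDegree_factorPoly, hl]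

include hn hd hn1 hL hΛ hl in
theorem surjOn_branchedPoly (hw : Function.Injective w) (hn2 : 1 < n) :
    Set.SurjOn (branchedPoly i₀ w) (hurwitzMap e i₀ ⁻¹' {hurwitzTarget e w}) (sSet n Λ w) := by
  rintro P ⟨⟨hdeg, hmon, hP0⟩, hram⟩
  have hcard := fun i => (ramType_eq_iff hdeg hn1 (hΛ i)).1 (hram i)
  choose Q hQ hQd hQm using fun i (m : Fin n) => exists_map_eq_prod_of_conj
    fun a (ha : a ∈ rootsOfMultiplicity ((P - C (w i)).map (algebraMap ℝ ℂ)) (m + 1)) =>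
      conj_mem_rootsOfMultiplicity ha
  set x : (Σ i : Fin k, Σ m : Fin n, Fin (l i m)) ⊕ Unit → ℝ :=
    Sum.elim (fun q => (Q q.1 q.2.1).coeff q.2.2) fun _ => P.coeff 0
  have hfac : ∀ i m, factorPoly x i m = Q i m := fun i m => by
    have h1 : (Q i m).natDegree = l i m := by rw [hQd, hcard, hl]
    ext j
    rcases lt_trichotomy j (l i m) with hj | hj | hj
    · exact coeff_factorPoly x i m ⟨j, hj⟩
    · rw [hj]
      nth_rewrite 1 [← natDegree_factorPoly x i m]
      rw [(monic_factorPoly x i m).coeff_natDegree, ← h1, (hQm i m).coeff_natDegree]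
    · rw [coeff_eq_zero_of_natDegree_lt (by rwa [natDegree_factorPoly]),
        coeff_eq_zero_of_natDegree_lt (by rwa [h1])]
  have hPm : ∀ i, (P - C (w i)).Monic := fun i =>
    hmon.sub_of_left (degree_C_le.trans_lt (by
      rw [degree_eq_natDegree hmon.ne_zero, hdeg]
      exact_mod_cast hn1))
  have hfull : ∀ i, fullPoly x i = P - C (w i) := fun i => by
    refine map_injective _ (algebraMap ℝ ℂ).injective ?_
    rw [eq_prod_rootsOfMultiplicity ((hPm i).map (algebraMap ℝ ℂ))
      ((natDegree_map _).trans (by rw [natDegree_sub_C, hdeg])), fullPoly, Polynomial.map_prod]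
    simp only [Polynomial.map_pow, hfac, hQ]
  have hder : ∀ i, derivative (fullPoly x i) = derivative P := fun i => by
    rw [hfull, derivative_sub, derivative_C, sub_zero]
  have hcop : ∀ i j, i ≠ j → IsCoprime (fullPoly x i) (fullPoly x j) := fun i j hij => by
    have h0 : w j - w i ≠ 0 := sub_ne_zero.2 (hw.ne hij.symm)
    refine ⟨C (w j - w i)⁻¹, -C (w j - w i)⁻¹, ?_⟩
    rw [neg_mul, ← sub_eq_add_neg, ← mul_sub, hfull, hfull, sub_sub_sub_cancel_left, ← C_sub,
      ← C_mul, inv_mul_cancel₀ h0, C_1]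
  have hdvd : ∏ j, ramPoly x j ∣ derivative P := by
    refine Finset.prod_dvd_of_coprime (fun i _ j _ hij => ?_) fun i _ => ?_
    · exact ((hcop i j hij).of_isCoprime_of_dvd_left
        ⟨_, fullPoly_eq x i⟩).of_isCoprime_of_dvd_right ⟨_, fullPoly_eq x j⟩
    · rw [← hder i, derivative_fullPoly]
      exact dvd_mul_right _ _
  have hP' : derivative P = C (n : ℝ) * ∏ j, ramPoly x j := by
    have h1 := eq_leadingCoeff_mul_of_monic_of_dvd_of_natDegree_le (monic_prod_ramPoly x) hdvd
      (by rw [natDegree_prod_ramPoly x hd, ← hdeg]; exact natDegree_derivative_le P)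
    have h2 : (derivative P).leadingCoeff = n := by
      rw [leadingCoeff, natDegree_derivative, coeff_derivative, hdeg, Nat.sub_add_cancel hn1,
        ← hdeg, hmon.coeff_natDegree, one_mul, ← Nat.cast_add_one, Nat.sub_add_cancel]
      omega
    rwa [h2] at h1
  refine ⟨x, (hurwitzMap_eq_target_iff e i₀ hn hd hn1 hL x w).2 ⟨fun i => ⟨?_, ?_⟩, ?_⟩, ?_⟩
  · refine (mul_eq_zero.1 ?_).resolve_left (monic_ramPoly x i).ne_zero
    rw [ramPoly_mul_critDefect, hder, hP', sub_self]
  · rw [hfull, coeff_sub, coeff_C_zero]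
    rfl
  · rw [hfull, coeff_sub, hP0, coeff_C_of_ne_zero (by omega), sub_zero]
  · rw [branchedPoly, hfull, sub_add_cancel]

end Hurwitz

section Invariance

variable {k n : ℕ} {l : Fin k → Fin n → ℕ} {L : Fin k → ℕ}
  (e : ∀ i, (Σ m, Fin (l i m)) ≃ Fin (L i)) (i₀ : Fin k)
  (he : ∀ i s t, e i s < e i t ↔ s.1 < t.1 ∨ (s.1 = t.1 ∧ (s.2 : ℕ) < t.2))
  (hn : ∀ i, ∑ m, l i m * ((m : ℕ) + 1) = n)
  (hd : ∑ i, ∑ m, l i m * (m : ℕ) = n - 1) (hn1 : 0 < n) (hL : ∀ i, ∑ m, l i m = L i)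
  {w : Fin k → ℝ} (hw : Function.Injective w)

include he hn hd hn1 hL hw in
theorem det_fderiv_hurwitzMap_ne_zero
    (x : (Σ i : Fin k, Σ m : Fin n, Fin (l i m)) ⊕ Unit → ℝ)
    (hx : hurwitzMap e i₀ x = hurwitzTarget e w) : (fderiv ℝ (hurwitzMap e i₀) x).det ≠ 0 := by
  obtain ⟨h1, h2⟩ := sign_det_fderiv_hurwitzMap e i₀ he hn hd hn1 hL hw hx
  intro h0
  rw [h0, sign_zero, SignType.coe_zero, eq_comm, mul_eq_zero] at h1
  rcases h1 with h1 | h1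
  · revert h1 h2
    cases orientationSign e i₀ <;> simp
  · exact pow_ne_zero _ (by norm_num) h1

include he hn hd hn1 hL hw in
theorem finite_fiber_hurwitzMap : (hurwitzMap e i₀ ⁻¹' {hurwitzTarget e w}).Finite :=
  finite_preimage_of_regular (contDiff_hurwitzMap e i₀)
    (boundedPreimages_hurwitzMap e i₀ hn hd hn1 hL)
    (det_fderiv_hurwitzMap_ne_zero e i₀ he hn hd hn1 hL hw)

variable {Λ : Fin k → Multiset ℕ} (hΛ : ∀ i, IsPartitionOf n (Λ i))
  (hl : ∀ i m, l i m = (Λ i).count ((m : ℕ) + 1))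

include e i₀ he hn hd hn1 hL hw hΛ hl in
theorem finite_sSet (hn2 : 1 < n) : (sSet n Λ w).Finite :=
  ((finite_fiber_hurwitzMap e i₀ he hn hd hn1 hL hw).image _).subset
    (surjOn_branchedPoly e i₀ hn hd hn1 hL hΛ hl hw hn2)

include he hn hd hn1 hL hw hΛ hl in
theorem finsum_sign_det_hurwitzMap (hn2 : 1 < n) :
    ∑ᶠ x ∈ hurwitzMap e i₀ ⁻¹' {hurwitzTarget e w},
        (SignType.sign (fderiv ℝ (hurwitzMap e i₀) x).det : ℤ) =
      orientationSign e i₀ * ∑ᶠ P ∈ sSet n Λ w, epsilonP P := by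
  have hbij : Set.BijOn (branchedPoly i₀ w) (hurwitzMap e i₀ ⁻¹' {hurwitzTarget e w})
      (sSet n Λ w) :=
    ⟨mapsTo_branchedPoly e i₀ hn hd hn1 hL hΛ hl hw hn2,
      injOn_branchedPoly e i₀ hn hd hn1 hL hw,
      surjOn_branchedPoly e i₀ hn hd hn1 hL hΛ hl hw hn2⟩
  have hsum : ∑ᶠ x ∈ hurwitzMap e i₀ ⁻¹' {hurwitzTarget e w}, epsilonP (branchedPoly i₀ w x) =
      ∑ᶠ P ∈ sSet n Λ w, epsilonP P := finsum_mem_eq_of_bijOn _ hbij fun _ _ => rfl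
  rw [← hsum]
  refine (finsum_mem_congr rfl fun x hx =>
    (sign_det_fderiv_hurwitzMap e i₀ he hn hd hn1 hL hw hx).1).trans ?_
  exact (mul_finsum_mem _ _).symm

include e i₀ he hn hd hn1 hL hw hΛ hl in
theorem finsum_epsilonP_eq {w' : Fin k → ℝ} (hw' : Function.Injective w') (hn2 : 1 < n) :
    ∑ᶠ P ∈ sSet n Λ w, epsilonP P = ∑ᶠ P ∈ sSet n Λ w', epsilonP P := by
  by_cases ho : orientationSign e i₀ = 0
  · have hempty : ∀ v : Fin k → ℝ, Function.Injective v → sSet n Λ v = ∅ := fun v hv =>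
      Set.eq_empty_of_forall_notMem fun P hP => by
        obtain ⟨x, hx, -⟩ := surjOn_branchedPoly e i₀ hn hd hn1 hL hΛ hl hv hn2 hP
        exact (sign_det_fderiv_hurwitzMap e i₀ he hn hd hn1 hL hv hx).2 ho
    rw [hempty w hw, hempty w' hw']
  · have h := sum_sign_det_eq (contDiff_hurwitzMap e i₀)
      (boundedPreimages_hurwitzMap e i₀ hn hd hn1 hL)
      (det_fderiv_hurwitzMap_ne_zero e i₀ he hn hd hn1 hL hw)
      (det_fderiv_hurwitzMap_ne_zero e i₀ he hn hd hn1 hL hw')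
    rw [finsum_sign_det_hurwitzMap e i₀ he hn hd hn1 hL hw hΛ hl hn2,
      finsum_sign_det_hurwitzMap e i₀ he hn hd hn1 hL hw' hΛ hl hn2] at h
    refine mul_left_cancel₀ ?_ h
    revert ho
    cases orientationSign e i₀ <;> simp

end Invariance

/-- The invariance theorem: the s-number does not depend on the positions of the real
branch points (in particular, not on their order on the real line), only on the
partitions `Λ₁,…,Λ_k`. -/
theorem invariance_theorem (n k : ℕ) (hk : 0 < k) (hkn : k < n)
    (Λ : Fin k → Multiset ℕ) (hΛ : ∀ i, IsPartitionOf n (Λ i))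
    (hsum : ∑ i, (n - Multiset.card (Λ i)) = n - 1)
    (w w' : Fin k → ℝ) (hw : Function.Injective w) (hw' : Function.Injective w') :
    (sSet n Λ w).Finite ∧ (sSet n Λ w').Finite ∧
      ∑ᶠ P ∈ sSet n Λ w, epsilonP P = ∑ᶠ P ∈ sSet n Λ w', epsilonP P := by
  have hn1 : 0 < n := by omega
  have hn2 : 1 < n := by omega
  have hn : ∀ i, ∑ m : Fin n, (Λ i).count ((m : ℕ) + 1) * ((m : ℕ) + 1) = n :=
    fun i => (hΛ i).sum_count_mul_succ
  have hL : ∀ i, ∑ m : Fin n, (Λ i).count ((m : ℕ) + 1) = Multiset.card (Λ i) :=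
    fun i => (hΛ i).sum_count
  have hd : ∑ i, ∑ m : Fin n, (Λ i).count ((m : ℕ) + 1) * (m : ℕ) = n - 1 := by
    rw [← hsum]
    refine Finset.sum_congr rfl fun i _ => ?_
    have h := hn i
    simp only [mul_add, mul_one, Finset.sum_add_distrib, hL i] at h
    omega
  choose e he using fun i => exists_lex_equiv (fun m : Fin n => (Λ i).count ((m : ℕ) + 1)) (hL i)
  exact ⟨finite_sSet e ⟨0, hk⟩ he hn hd hn1 hL hw hΛ (fun _ _ => rfl) hn2,
    finite_sSet e ⟨0, hk⟩ he hn hd hn1 hL hw' hΛ (fun _ _ => rfl) hn2,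
    finsum_epsilonP_eq e ⟨0, hk⟩ he hn hd hn1 hL hw hΛ (fun _ _ => rfl) hw' hn2⟩
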